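/- arXiv:math/0202109 — 3 statements merged into one kernel-verified Lean document; each statement's English description precedes it below -/
import Mathlib

section
/- Let K ⊂ ℝ be a real quadratic field with nontrivial automorphism σ and trace Tr(x) = x + σ(x), let L ⊂ K be a pseudolattice, and let l₀, m₀ ∈ K, η₀, η₁ ∈ ℝ, η := η₀ + i·η₁. Let ε ∈ K satisfy: ε > 1, ε·σ(ε) = 1, ε·L = L, (ε − 1)·l₀ ∈ L, Tr((ε − 1)·l·σ(m₀)) ∈ ℤ for all l ∈ L, and Tr((ε − 1)·l₀·σ(m₀)) ∈ 2ℤ. Let S ⊂ l₀ + L be a set meeting each orbit {ε^n·x : n ∈ ℤ} of the multiplication action of ε on l₀ + L in exactly one point. Then for every v ∈ ℂ with Im v > 0: Σ_{x ∈ S} (η₀·sgn(σ(x)) + η₁·sgn(x))·e^{2πi·v·|x·σ(x)|}·e^{−2πi·Tr((x−l₀)·σ(m₀))}·e^{−πi·Tr(l₀·σ(m₀))} = √(−iv)·∫_{−log ε}^{log ε} [ Σ_{l ∈ L} ((λ_t(l₀+l))·η)·e^{πi·v·|λ_t(l₀+l)|²}·e^{−2πi·Tr(l·σ(m₀))}·e^{−πi·Tr(l₀·σ(m₀))}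 ] dt, where all series converge absolutely, the t-integrand is integrable, and √(−iv) is the principal square root (positive when v lies on the positive imaginary axis). -/
open Real

/-- Hecke's map `λ_t : K → ℂ`, `λ_t(l) = l·e^{t/2} + i·σ(l)·e^{−t/2}`. -/
noncomputable def lamt (K : IntermediateField ℚ ℝ) (σ : K ≃+* K) (t : ℝ) (l : K) : ℂ :=
  (((l : ℝ) * Real.exp (t / 2) : ℝ) : ℂ) +
    Complex.I * ((((σ l : ℝ)) * Real.exp (-t / 2) : ℝ) : ℂ)

/-- The trace `Tr(x) = x + σ(x)` of the real quadratic field `K`. -/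
noncomputable def trK (K : IntermediateField ℚ ℝ) (σ : K ≃+* K) (x : K) : ℝ :=
  (x : ℝ) + (σ x : ℝ)

noncomputable def GG (a : ℂ) (η₀ η₁ p q t : ℝ) : ℂ :=
  ((η₁ * (p * Real.exp (t / 2)) + η₀ * (q * Real.exp (-t / 2)) : ℝ) : ℂ) *
    Complex.exp (-a * ((p ^ 2 * Real.exp t + q ^ 2 * Real.exp (-t) : ℝ) : ℂ))

lemma GG_congr (a : ℂ) {A A' B B' : ℝ} (h : A = A') (h' : B = B') :
    (A : ℂ) * Complex.exp (-a * (B : ℂ)) = (A' : ℂ) * Complex.exp (-a * (B' : ℂ)) := by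
  rw [h, h']

lemma GG_cont (a : ℂ) (η₀ η₁ p q : ℝ) : Continuous (GG a η₀ η₁ p q) := by
  unfold GG
  fun_prop

lemma GG_shift (a : ℂ) (η₀ η₁ p q t s : ℝ) :
    GG a η₀ η₁ p q (t + 2 * s) = GG a η₀ η₁ (Real.exp s * p) (Real.exp (-s) * q) t := by
  unfold GG
  have h1 : Real.exp ((t + 2 * s) / 2) = Real.exp s * Real.exp (t / 2) := by
    rw [← Real.exp_add]; congr 1; ring
  have h2 : Real.exp (-(t + 2 * s) / 2) = Real.exp (-s) * Real.exp (-t / 2) := by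
    rw [← Real.exp_add]; congr 1; ring
  have h3 : Real.exp (t + 2 * s) = Real.exp s ^ 2 * Real.exp t := by
    rw [← Real.exp_nat_mul, ← Real.exp_add]; congr 1; push_cast; ring
  have h4 : Real.exp (-(t + 2 * s)) = Real.exp (-s) ^ 2 * Real.exp (-t) := by
    rw [← Real.exp_nat_mul, ← Real.exp_add]; congr 1; push_cast; ring
  rw [h1, h2, h3, h4]
  apply GG_congr <;> ring

lemma GG_norm (a : ℂ) (η₀ η₁ p q t : ℝ) : ‖GG a η₀ η₁ p q t‖ =
    |η₁ * (p * Real.exp (t / 2)) + η₀ * (q * Real.exp (-t / 2))| *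
    Real.exp (-a.re * (p ^ 2 * Real.exp t + q ^ 2 * Real.exp (-t))) := by
  unfold GG
  rw [norm_mul, Complex.norm_exp, Complex.norm_real, Real.norm_eq_abs, Complex.re_mul_ofReal,
    Complex.neg_re]

/-- the integral with both positive, sum -/
lemma int_sum (a : ℂ) (ha : 0 < a.re) (p q : ℝ) (hp : 0 < p) (hq : 0 < q) :
    MeasureTheory.Integrable (GG a 1 1 p q) ∧
    ∫ t, GG a 1 1 p q t = 2 * ((π / a) ^ (1 / 2 : ℂ) * Complex.exp (-2 * a * ((p * q : ℝ) : ℂ))) := by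
  set w : ℝ → ℝ := fun t => p * Real.exp (t / 2) - q * Real.exp (-t / 2) with hw
  set w' : ℝ → ℝ := fun t => (p * Real.exp (t / 2) + q * Real.exp (-t / 2)) / 2 with hw'
  have hpos : ∀ t, 0 < w' t := fun t => by simp only [hw']; positivity
  have hd : ∀ t, HasDerivAt w (w' t) t := by
    intro t
    have e1 : HasDerivAt (fun t : ℝ => t / 2) (1 / 2) t := (hasDerivAt_id t).div_const 2
    have e2 : HasDerivAt (fun t : ℝ => -t / 2) (-1 / 2) t := (hasDerivAt_id t).neg.div_const 2
    have e3 := (e1.exp.const_mul p).sub (e2.exp.const_mul q)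
    have e4 : w' t = p * (rexp (t / 2) * (1 / 2)) - q * (rexp (-t / 2) * (-1 / 2)) := by
      simp only [hw']; ring
    rw [e4]
    exact e3
  have hmono : StrictMono w := by
    apply strictMono_of_deriv_pos
    intro t; rw [(hd t).deriv]; exact hpos t
  have hcont : Continuous w := by simp only [hw]; fun_prop
  have hsurj : Function.Surjective w := by
    apply hcont.surjective
    · have h1 : Filter.Tendsto (fun t : ℝ => p * Real.exp (t / 2)) Filter.atTop Filter.atTop :=
        (Real.tendsto_exp_atTop.comp (Filter.tendsto_id.atTop_div_const two_pos)).const_mul_atTop hp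
      have h2 : ∀ᶠ t : ℝ in Filter.atTop, - q ≤ - (q * Real.exp (-t / 2)) := by
        filter_upwards [Filter.eventually_ge_atTop 0] with t ht
        have : Real.exp (-t / 2) ≤ 1 := Real.exp_le_one_iff.2 (by linarith)
        nlinarith
      simpa [hw, sub_eq_add_neg] using Filter.tendsto_atTop_add_right_of_le' _ _ h1 h2
    · have h1 : Filter.Tendsto (fun t : ℝ => - (q * Real.exp (-t / 2))) Filter.atBot Filter.atBot := by
        apply Filter.tendsto_neg_atTop_atBot.comp
        refine (Real.tendsto_exp_atTop.comp ?_).const_mul_atTop hq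
        exact Filter.tendsto_neg_atBot_atTop.atTop_div_const two_pos
      have h2 : ∀ᶠ t : ℝ in Filter.atBot, p * Real.exp (t / 2) ≤ p := by
        filter_upwards [Filter.eventually_le_atBot 0] with t ht
        have : Real.exp (t / 2) ≤ 1 := Real.exp_le_one_iff.2 (by linarith)
        nlinarith
      simpa [hw, sub_eq_add_neg] using Filter.tendsto_atBot_add_left_of_ge' _ _ h2 h1
  have himg : w '' Set.univ = Set.univ := by rw [Set.image_univ, hsurj.range_eq]
  have hIntg := MeasureTheory.integral_image_eq_integral_abs_deriv_smul (s := Set.univ) (f := w)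
    (f' := w') MeasurableSet.univ (fun t _ => (hd t).hasDerivWithinAt) hmono.injective.injOn
    (fun u : ℝ => Complex.exp (-a * (u : ℂ) ^ 2))
  have hIntg2 := MeasureTheory.integrableOn_image_iff_integrableOn_abs_deriv_smul (s := Set.univ) (f := w)
    (f' := w') MeasurableSet.univ (fun t _ => (hd t).hasDerivWithinAt) hmono.injective.injOn
    (fun u : ℝ => Complex.exp (-a * (u : ℂ) ^ 2))
  rw [himg] at hIntg hIntg2
  simp only [MeasureTheory.setIntegral_univ, MeasureTheory.integrableOn_univ] at hIntg hIntg2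
  have key : ∀ t, GG a 1 1 p q t = (2 * Complex.exp (-2 * a * ((p * q : ℝ) : ℂ))) *
      (|w' t| • Complex.exp (-a * ((w t : ℝ) : ℂ) ^ 2)) := by
    intro t
    rw [abs_of_pos (hpos t)]
    have e0 : Real.exp (t / 2) * Real.exp (-t / 2) = 1 := by
      rw [← Real.exp_add]; simp [neg_div]
    have e1 : Real.exp t = Real.exp (t / 2) ^ 2 := by
      rw [← Real.exp_nat_mul]; congr 1; push_cast; ring
    have e2 : Real.exp (-t) = Real.exp (-t / 2) ^ 2 := by
      rw [← Real.exp_nat_mul]; congr 1; push_cast; ring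
    have e3 : p ^ 2 * Real.exp t + q ^ 2 * Real.exp (-t) = 2 * (p * q) + (w t) ^ 2 := by
      rw [e1, e2]; simp only [hw]; linear_combination (2 * p * q) * e0
    unfold GG
    rw [e3, Complex.real_smul]
    have : -a * ((2 * (p * q) + (w t) ^ 2 : ℝ) : ℂ) =
      (-2 * a * ((p * q : ℝ) : ℂ)) + (-a * ((w t : ℝ) : ℂ) ^ 2) := by push_cast; ring
    rw [this, Complex.exp_add]
    simp only [hw']
    push_cast
    ring
  have hG : GG a 1 1 p q = fun t => (2 * Complex.exp (-2 * a * ((p * q : ℝ) : ℂ))) *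
      (|w' t| • Complex.exp (-a * ((w t : ℝ) : ℂ) ^ 2)) := funext key
  constructor
  · rw [hG]
    exact (hIntg2.1 (integrable_cexp_neg_mul_sq ha)).const_mul _
  · rw [hG, MeasureTheory.integral_const_mul, ← hIntg, integral_gaussian_complex ha]
    ring

lemma int_one (a : ℂ) (ha : 0 < a.re) (p q : ℝ) (hp : 0 < p) (hq : 0 < q) :
    MeasureTheory.Integrable (GG a 0 1 p q) ∧ MeasureTheory.Integrable (GG a 1 0 p q) ∧
    (∫ t, GG a 0 1 p q t = (π / a) ^ (1 / 2 : ℂ) * Complex.exp (-2 * a * ((p * q : ℝ) : ℂ))) ∧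
    (∫ t, GG a 1 0 p q t = (π / a) ^ (1 / 2 : ℂ) * Complex.exp (-2 * a * ((p * q : ℝ) : ℂ))) := by
  obtain ⟨hi, hs⟩ := int_sum a ha p q hp hq
  have i1 : MeasureTheory.Integrable (GG a 0 1 p q) := by
    refine hi.mono (GG_cont _ _ _ _ _).aestronglyMeasurable (Filter.Eventually.of_forall fun t => ?_)
    rw [GG_norm, GG_norm]
    refine mul_le_mul_of_nonneg_right ?_ (Real.exp_pos _).le
    have := mul_pos hp (Real.exp_pos (t / 2))
    have := mul_pos hq (Real.exp_pos (-t / 2))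
    rw [abs_of_nonneg (by linarith), abs_of_nonneg (by linarith)]; linarith
  have i2 : MeasureTheory.Integrable (GG a 1 0 p q) := by
    refine hi.mono (GG_cont _ _ _ _ _).aestronglyMeasurable (Filter.Eventually.of_forall fun t => ?_)
    rw [GG_norm, GG_norm]
    refine mul_le_mul_of_nonneg_right ?_ (Real.exp_pos _).le
    have := mul_pos hp (Real.exp_pos (t / 2))
    have := mul_pos hq (Real.exp_pos (-t / 2))
    rw [abs_of_nonneg (by linarith), abs_of_nonneg (by linarith)]; linarith
  have hadd : ∫ t, GG a 1 1 p q t = (∫ t, GG a 0 1 p q t) + ∫ t, GG a 1 0 p q t := by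
    rw [← MeasureTheory.integral_add i1 i2]
    congr 1; ext t; unfold GG; push_cast; ring_nf
  have hsym : (∫ t, GG a 0 1 p q t) = ∫ t, GG a 1 0 p q t := by
    set c := 2 * Real.log (q / p) with hc
    rw [← MeasureTheory.integral_sub_left_eq_self (fun t => GG a 0 1 p q t) MeasureTheory.volume c]
    congr 1; ext t
    have e : Real.exp (Real.log (q / p)) = q / p := Real.exp_log (by positivity)
    have h1 : Real.exp ((c - t) / 2) = q / p * Real.exp (-t / 2) := by
      rw [← e, ← Real.exp_add]; congr 1; rw [hc]; ring
    have h3 : Real.exp (c - t) = (q / p) ^ 2 * Real.exp (-t) := by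
      rw [← e, ← Real.exp_nat_mul, ← Real.exp_add]; congr 1
    have h4 : Real.exp (-(c - t)) = (p / q) ^ 2 * Real.exp t := by
      have : p / q = Real.exp (- Real.log (q / p)) := by rw [Real.exp_neg, e, inv_div]
      rw [this, ← Real.exp_nat_mul, ← Real.exp_add]; congr 1; rw [hc]; push_cast; ring
    unfold GG
    rw [h1, h3, h4]
    apply GG_congr
    · field_simp; simp
    · field_simp; ring
  rw [hs, hsym] at hadd
  have h2 : (∫ t, GG a 1 0 p q t) =
      (π / a) ^ (1 / 2 : ℂ) * Complex.exp (-2 * a * ((p * q : ℝ) : ℂ)) := by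
    linear_combination (-1 / 2 : ℂ) * hadd
  exact ⟨i1, i2, hsym.trans h2, h2⟩

lemma GG_decomp (a : ℂ) (η₀ η₁ p q t : ℝ) :
    GG a η₀ η₁ p q t = ((η₁ * Real.sign p : ℝ) : ℂ) * GG a 0 1 |p| |q| t +
      ((η₀ * Real.sign q : ℝ) : ℂ) * GG a 1 0 |p| |q| t := by
  have s : ∀ x : ℝ, x = Real.sign x * |x| := fun x => by
    rcases lt_trichotomy x 0 with h | h | h
    · rw [Real.sign_of_neg h, abs_of_neg h]; ring
    · simp [h]
    · rw [Real.sign_of_pos h, abs_of_pos h]; ring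
  unfold GG
  rw [sq_abs, sq_abs]
  have : (η₁ * (p * Real.exp (t / 2)) + η₀ * (q * Real.exp (-t / 2)) : ℝ) =
    η₁ * Real.sign p * (1 * (|p| * Real.exp (t / 2)) + 0 * (|q| * Real.exp (-t / 2))) +
    η₀ * Real.sign q * (0 * (|p| * Real.exp (t / 2)) + 1 * (|q| * Real.exp (-t / 2))) := by
    linear_combination (η₁ * Real.exp (t / 2)) * s p + η₀ * Real.exp (-t / 2) * s q
  rw [this]
  push_cast
  ring

lemma GG_int (a : ℂ) (ha : 0 < a.re) (η₀ η₁ p q : ℝ) (hp : p ≠ 0) (hq : q ≠ 0) :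
    MeasureTheory.Integrable (GG a η₀ η₁ p q) ∧
    ∫ t, GG a η₀ η₁ p q t = ((η₀ * Real.sign q + η₁ * Real.sign p : ℝ) : ℂ) *
      ((π / a) ^ (1 / 2 : ℂ) * Complex.exp (-2 * a * ((|p * q| : ℝ) : ℂ))) := by
  obtain ⟨i1, i2, h1, h2⟩ := int_one a ha |p| |q| (abs_pos.2 hp) (abs_pos.2 hq)
  have hG := funext fun t => GG_decomp a η₀ η₁ p q t
  constructor
  · rw [show GG a η₀ η₁ p q = fun t => GG a η₀ η₁ p q t from rfl, hG]
    exact (i1.const_mul _).add (i2.const_mul _)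
  · rw [hG, MeasureTheory.integral_add (i1.const_mul _) (i2.const_mul _),
      MeasureTheory.integral_const_mul, MeasureTheory.integral_const_mul, h1, h2, abs_mul]
    push_cast
    ring

/-- unfolding the integral over one geodesic -/
lemma GG_unfold (a : ℂ) (η₀ η₁ p q ℓ : ℝ) (hℓ : 0 < ℓ)
    (hi : MeasureTheory.Integrable (GG a η₀ η₁ p q)) :
    HasSum (fun n : ℤ => ∫ t in (-ℓ)..ℓ, GG a η₀ η₁ (Real.exp (n * ℓ) * p) (Real.exp (-(n * ℓ)) * q) t)
      (∫ t, GG a η₀ η₁ p q t) := by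
  have h2 : (2 * ℓ) ≠ 0 := by positivity
  have hi' := hi.comp_mul_left' h2
  have H := (hi'.hasSum_intervalIntegral (-1 / 2)).mul_left ((2 * ℓ : ℝ) : ℂ)
  have hA : (fun n : ℤ => ∫ t in (-ℓ)..ℓ, GG a η₀ η₁ (Real.exp (n * ℓ) * p) (Real.exp (-(n * ℓ)) * q) t)
      = fun n : ℤ => ((2 * ℓ : ℝ) : ℂ) *
        ∫ x in (-1 / 2 + n : ℝ)..(-1 / 2 + n + 1), GG a η₀ η₁ p q (2 * ℓ * x) := by
    ext n
    simp_rw [← GG_shift]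
    rw [intervalIntegral.integral_comp_add_right (fun t => GG a η₀ η₁ p q t),
      intervalIntegral.integral_comp_mul_left (fun t => GG a η₀ η₁ p q t) h2,
      Complex.real_smul, Complex.ofReal_inv, mul_inv_cancel_left₀ (by exact_mod_cast h2)]
    congr 1 <;> ring
  have hB : ∫ t, GG a η₀ η₁ p q t = ((2 * ℓ : ℝ) : ℂ) * ∫ x, GG a η₀ η₁ p q (2 * ℓ * x) := by
    rw [MeasureTheory.Measure.integral_comp_mul_left (fun t => GG a η₀ η₁ p q t),
      abs_of_pos (by positivity),
      Complex.real_smul, Complex.ofReal_inv, mul_inv_cancel_left₀ (by exact_mod_cast h2)]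
  rw [hA, hB]
  exact H

lemma GG_bound (a : ℂ) (ha : 0 < a.re) (η₀ η₁ T : ℝ) :
    ∃ C c : ℝ, 0 < c ∧ ∀ p q t : ℝ, |t| ≤ T →
      ‖GG a η₀ η₁ p q t‖ ≤ C * Real.exp (-c * (p ^ 2 + q ^ 2)) := by
  set c := a.re * Real.exp (-T) / 2 with hc
  have hcp : 0 < c := by positivity
  refine ⟨(|η₁| + |η₀|) * Real.exp T * (1 + 1 / c), c, hcp, fun p q t ht => ?_⟩
  obtain ⟨ht1, ht2⟩ := abs_le.1 ht
  have hT : 0 ≤ T := (abs_nonneg t).trans ht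
  set s := p ^ 2 + q ^ 2 with hs
  have hs0 : 0 ≤ s := by positivity
  have hE : Real.exp (-a.re * (p ^ 2 * Real.exp t + q ^ 2 * Real.exp (-t))) ≤
      Real.exp (-c * s) * Real.exp (-c * s) := by
    rw [← Real.exp_add, Real.exp_le_exp]
    have e1 : Real.exp (-T) ≤ Real.exp t := Real.exp_le_exp.2 ht1
    have e2 : Real.exp (-T) ≤ Real.exp (-t) := Real.exp_le_exp.2 (by linarith)
    have : Real.exp (-T) * s ≤ p ^ 2 * Real.exp t + q ^ 2 * Real.exp (-t) := by
      rw [hs]; nlinarith [mul_le_mul_of_nonneg_left e1 (sq_nonneg p), mul_le_mul_of_nonneg_left e2 (sq_nonneg q)]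
    have := mul_le_mul_of_nonneg_left this ha.le
    rw [hc]; linarith
  have hA : |η₁ * (p * Real.exp (t / 2)) + η₀ * (q * Real.exp (-t / 2))| ≤
      (|η₁| + |η₀|) * Real.exp T * (1 + s) := by
    have b1 : Real.exp (t / 2) ≤ Real.exp T := Real.exp_le_exp.2 (by linarith)
    have b2 : Real.exp (-t / 2) ≤ Real.exp T := Real.exp_le_exp.2 (by linarith)
    have b3 : |p| ≤ 1 + s := by rw [hs]; nlinarith [sq_abs p, sq_nonneg (|p| - 1), sq_nonneg q, abs_nonneg p]
    have b4 : |q| ≤ 1 + s := by rw [hs]; nlinarith [sq_abs q, sq_nonneg (|q| - 1), sq_nonneg p, abs_nonneg q]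
    calc _ ≤ |η₁ * (p * Real.exp (t / 2))| + |η₀ * (q * Real.exp (-t / 2))| := abs_add_le _ _
      _ = |η₁| * (|p| * Real.exp (t / 2)) + |η₀| * (|q| * Real.exp (-t / 2)) := by
        simp only [abs_mul, Real.abs_exp]
      _ ≤ |η₁| * ((1 + s) * Real.exp T) + |η₀| * ((1 + s) * Real.exp T) := by gcongr
      _ = _ := by ring
  have hS : (1 + s) * Real.exp (-c * s) ≤ 1 + 1 / c := by
    have h1 : Real.exp (-c * s) ≤ 1 := Real.exp_le_one_iff.2 (by nlinarith)
    have h2 : (c * s) * Real.exp (-c * s) ≤ 1 := by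
      have := Real.add_one_le_exp (c * s)
      have e : Real.exp (c * s) * Real.exp (-c * s) = 1 := by rw [← Real.exp_add]; simp
      nlinarith [Real.exp_pos (-c * s)]
    have h3 : s * Real.exp (-c * s) ≤ 1 / c := by rw [le_div_iff₀ hcp]; linarith
    linarith
  rw [GG_norm]
  calc _ ≤ (|η₁| + |η₀|) * Real.exp T * (1 + s) * (Real.exp (-c * s) * Real.exp (-c * s)) := by
        gcongr
    _ = (|η₁| + |η₀|) * Real.exp T * ((1 + s) * Real.exp (-c * s)) * Real.exp (-c * s) := by ring
    _ ≤ _ := by gcongr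

lemma gauss_sum (k : ℝ) (hk : 0 < k) : Summable fun n : ℤ => Real.exp (-k * (n : ℝ) ^ 2) := by
  have h : 0 < (Complex.I * ((k / π : ℝ) : ℂ)).im := by
    simp only [Complex.mul_im, Complex.I_re, Complex.I_im, Complex.ofReal_re, Complex.ofReal_im]
    have := Real.pi_pos
    simp only [zero_mul, one_mul, zero_add]
    positivity
  have := ((summable_jacobiTheta₂_term_iff 0 _).2 h).norm
  convert this using 2 with n
  rw [jacobiTheta₂_term, mul_zero, zero_add, Complex.norm_exp]
  congr 1
  have : (π : ℂ) * Complex.I * (n : ℂ) ^ 2 * (Complex.I * ((k / π : ℝ) : ℂ)) = ((-k * (n : ℝ) ^ 2 : ℝ) : ℂ) := by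
    have : (π : ℂ) ≠ 0 := by exact_mod_cast Real.pi_ne_zero
    push_cast
    field_simp
    rw [Complex.I_sq]; ring
  rw [this, Complex.ofReal_re]

lemma lattice_sum (p₀ q₀ p₁ q₁ p₂ q₂ c : ℝ) (hc : 0 < c) (hD : p₁ * q₂ - p₂ * q₁ ≠ 0) :
    Summable fun mn : ℤ × ℤ => Real.exp (-c * ((p₀ + (mn.1 * p₁ + mn.2 * p₂)) ^ 2 +
      (q₀ + (mn.1 * q₁ + mn.2 * q₂)) ^ 2)) := by
  set D := p₁ * q₂ - p₂ * q₁ with hDdef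
  set M := p₁ ^ 2 + q₁ ^ 2 + p₂ ^ 2 + q₂ ^ 2 with hM
  have hMpos : 0 < M := by
    have : 0 < D ^ 2 := by positivity
    have h0 : 0 ≤ M := by positivity
    rcases h0.lt_or_eq with h | h
    · exact h
    · exfalso; apply hD
      have : p₁ = 0 := by nlinarith [sq_nonneg p₁, sq_nonneg p₂, sq_nonneg q₁, sq_nonneg q₂]
      have : p₂ = 0 := by nlinarith [sq_nonneg p₁, sq_nonneg p₂, sq_nonneg q₁, sq_nonneg q₂]
      rw [hDdef]; simp only [‹p₁ = 0›, ‹p₂ = 0›]; ring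
  set k := c * D ^ 2 / (4 * M) with hk
  have hkpos : 0 < k := by positivity
  have hs := ((gauss_sum k hkpos).mul_of_nonneg (gauss_sum k hkpos) (fun _ => (Real.exp_pos _).le)
    (fun _ => (Real.exp_pos _).le)).mul_left (Real.exp (c * (p₀ ^ 2 + q₀ ^ 2)))
  refine Summable.of_nonneg_of_le (fun _ => (Real.exp_pos _).le) (fun mn => ?_) hs
  obtain ⟨m, n⟩ := mn
  simp only
  rw [← Real.exp_add, ← Real.exp_add, Real.exp_le_exp]
  set P := p₀ + (m * p₁ + n * p₂) with hP
  set Q := q₀ + (m * q₁ + n * q₂) with hQ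
  have key : D ^ 2 * ((m : ℝ) ^ 2 + (n : ℝ) ^ 2) ≤ 4 * M * (P ^ 2 + Q ^ 2 + p₀ ^ 2 + q₀ ^ 2) := by
    have em : D * m = (P - p₀) * q₂ - (Q - q₀) * p₂ := by rw [hP, hQ, hDdef]; ring
    have en : D * n = (Q - q₀) * p₁ - (P - p₀) * q₁ := by rw [hP, hQ, hDdef]; ring
    have e1 : (D * m) ^ 2 ≤ ((P - p₀) ^ 2 + (Q - q₀) ^ 2) * (p₂ ^ 2 + q₂ ^ 2) := by
      rw [em]; nlinarith [sq_nonneg ((P - p₀) * p₂ + (Q - q₀) * q₂)]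
    have e2 : (D * n) ^ 2 ≤ ((P - p₀) ^ 2 + (Q - q₀) ^ 2) * (p₁ ^ 2 + q₁ ^ 2) := by
      rw [en]; nlinarith [sq_nonneg ((P - p₀) * p₁ + (Q - q₀) * q₁)]
    have e3 : (P - p₀) ^ 2 + (Q - q₀) ^ 2 ≤ 4 * (P ^ 2 + Q ^ 2 + p₀ ^ 2 + q₀ ^ 2) := by
      nlinarith [sq_nonneg (P + p₀), sq_nonneg (Q + q₀), sq_nonneg P, sq_nonneg Q, sq_nonneg p₀, sq_nonneg q₀]
    calc _ = (D * m) ^ 2 + (D * n) ^ 2 := by ring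
      _ ≤ ((P - p₀) ^ 2 + (Q - q₀) ^ 2) * M := by rw [hM]; linarith
      _ ≤ _ := by nlinarith
  have : k * ((m : ℝ) ^ 2 + (n : ℝ) ^ 2) ≤ c * (P ^ 2 + Q ^ 2 + p₀ ^ 2 + q₀ ^ 2) := by
    rw [hk, div_mul_eq_mul_div, div_le_iff₀ (by positivity)]
    nlinarith [mul_le_mul_of_nonneg_left key hc.le]
  linarith

lemma det_ne (K : IntermediateField ℚ ℝ) (hK2 : Module.finrank ℚ K = 2)
    (σ : K ≃+* K) (hσ : ∃ x : K, σ x ≠ x)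
    (l₁ l₂ : K) (hli : LinearIndependent ℚ ![(l₁ : ℝ), (l₂ : ℝ)]) :
    (l₁ : ℝ) * (σ l₂ : ℝ) - (l₂ : ℝ) * (σ l₁ : ℝ) ≠ 0 := by
  intro h0
  have h : l₁ * σ l₂ = l₂ * σ l₁ := by
    apply Subtype.ext
    push_cast
    linarith
  have hli' : LinearIndependent ℚ ![l₁, l₂] := by
    apply LinearIndependent.of_comp K.val.toLinearMap
    have e : (K.val.toLinearMap : K → ℝ) ∘ ![l₁, l₂] = ![(l₁ : ℝ), (l₂ : ℝ)] := by
      ext i; fin_cases i <;> rfl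
    rw [e]
    exact hli
  have hl1 : l₁ ≠ 0 := hli'.ne_zero 0
  have hspan := hli'.span_eq_top_of_card_eq_finrank (by simp [hK2])
  obtain ⟨x, hx⟩ := hσ
  have hm : x * l₁ ∈ Submodule.span ℚ (Set.range ![l₁, l₂]) := by rw [hspan]; trivial
  rw [Matrix.range_cons, Matrix.range_cons, Matrix.range_empty, Set.union_empty,
    Set.singleton_union, Submodule.mem_span_pair] at hm
  obtain ⟨a, b, hab⟩ := hm
  rw [Algebra.smul_def, Algebra.smul_def, eq_ratCast, eq_ratCast] at hab
  have hab2 := congrArg σ hab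
  rw [map_add, map_mul, map_mul, map_mul, map_ratCast, map_ratCast] at hab2
  have hs1 : σ l₁ ≠ 0 := by simpa using hl1
  apply hx
  apply mul_right_cancel₀ hl1
  apply mul_right_cancel₀ hs1
  linear_combination (-l₁) * hab2 + σ l₁ * hab + (b : K) * h

lemma eps_real (K : IntermediateField ℚ ℝ) (σ : K ≃+* K) (ε : K)
    (hε1 : 1 < (ε : ℝ)) (hεnorm : ε * σ ε = 1) (n : ℤ) (x : K) :
    ((ε ^ n * x : K) : ℝ) = Real.exp (n * Real.log (ε : ℝ)) * (x : ℝ) ∧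
    ((σ (ε ^ n * x) : K) : ℝ) = Real.exp (-(n * Real.log (ε : ℝ))) * (σ x : ℝ) := by
  have h0 : (0 : ℝ) < ε := by linarith
  have hs : ((σ ε : K) : ℝ) = (ε : ℝ)⁻¹ := by
    have : (ε : ℝ) * ((σ ε : K) : ℝ) = 1 := by exact_mod_cast congrArg (fun z : K => (z : ℝ)) hεnorm
    exact eq_inv_of_mul_eq_one_right this
  have he : Real.exp (n * Real.log (ε : ℝ)) = (ε : ℝ) ^ n := by
    rw [mul_comm, Real.exp_mul, Real.exp_log h0, Real.rpow_intCast]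
  constructor
  · rw [he]; push_cast; rfl
  · rw [Real.exp_neg, he, map_mul, map_zpow₀]; push_cast
    have : ((σ ε ^ n : K) : ℝ) = ((σ ε : K) : ℝ) ^ n := map_zpow₀ K.val (σ ε) n
    rw [this, hs, inv_zpow]

lemma eps_mem (K : IntermediateField ℚ ℝ) (ε : K) (hε : ε ≠ 0) (L : AddSubgroup K) (l₀ : K)
    (hεL : ∀ l : K, l ∈ L ↔ ε * l ∈ L) (hεl₀ : (ε - 1) * l₀ ∈ L) (n : ℤ) :
    ∀ x : K, x - l₀ ∈ L ↔ ε ^ n * x - l₀ ∈ L := by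
  have h1 : ∀ x : K, x - l₀ ∈ L ↔ ε * x - l₀ ∈ L := by
    intro x
    rw [hεL (x - l₀)]
    have : ε * x - l₀ = ε * (x - l₀) + (ε - 1) * l₀ := by ring
    rw [this]
    exact (L.add_mem_cancel_right hεl₀).symm
  induction n with
  | zero => simp
  | succ n ih =>
    intro x
    rw [ih, h1, ← mul_assoc, ← zpow_one_add₀ hε, add_comm 1]
  | pred n ih =>
    intro x
    rw [ih, h1 (ε ^ (-(n : ℤ) - 1) * x), ← mul_assoc, ← zpow_one_add₀ hε]
    congr! 4; ring

/-- character -/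
noncomputable def chi (K : IntermediateField ℚ ℝ) (σ : K ≃+* K) (l₀ m₀ l : K) : ℂ :=
  Complex.exp (-2 * (π : ℂ) * Complex.I * ((trK K σ (l * σ m₀) : ℝ) : ℂ)) *
        Complex.exp (-(π : ℂ) * Complex.I * ((trK K σ (l₀ * σ m₀) : ℝ) : ℂ))

lemma chi_norm (K : IntermediateField ℚ ℝ) (σ : K ≃+* K) (l₀ m₀ l : K) : ‖chi K σ l₀ m₀ l‖ = 1 := by
  unfold chi
  rw [norm_mul, Complex.norm_exp, Complex.norm_exp]
  simp

lemma chi_inv (K : IntermediateField ℚ ℝ) (σ : K ≃+* K) (ε : K) (hε : ε ≠ 0) (L : AddSubgroup K)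
    (l₀ m₀ : K)
    (hεL : ∀ l : K, l ∈ L ↔ ε * l ∈ L) (hεl₀ : (ε - 1) * l₀ ∈ L)
    (hchar1 : ∀ l ∈ L, ∃ n : ℤ, trK K σ ((ε - 1) * l * σ m₀) = (n : ℝ))
    (hchar2 : ∃ n : ℤ, trK K σ ((ε - 1) * l₀ * σ m₀) = ((2 * n : ℤ) : ℝ)) (n : ℤ) :
    ∀ x : K, x - l₀ ∈ L → chi K σ l₀ m₀ (ε ^ n * x - l₀) = chi K σ l₀ m₀ (x - l₀) := by
  have h1 : ∀ x : K, x - l₀ ∈ L → chi K σ l₀ m₀ (ε * x - l₀) = chi K σ l₀ m₀ (x - l₀) := by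
    intro x hx
    obtain ⟨k, hk⟩ := hchar1 _ hx
    obtain ⟨j, hj⟩ := hchar2
    have e : trK K σ ((ε * x - l₀) * σ m₀) = trK K σ ((x - l₀) * σ m₀) + ((k + 2 * j : ℤ) : ℝ) := by
      have : (ε * x - l₀) * σ m₀ = (x - l₀) * σ m₀ + ((ε - 1) * (x - l₀) * σ m₀ +
        (ε - 1) * l₀ * σ m₀) := by ring
      have tadd : ∀ u w : K, trK K σ (u + w) = trK K σ u + trK K σ w := by
        intro u w; unfold trK; rw [map_add]; push_cast; ring
      rw [this, tadd, tadd, hk, hj]; push_cast; ring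
    unfold chi
    congr 1
    rw [e, Complex.exp_eq_exp_iff_exists_int]
    refine ⟨-(k + 2 * j), ?_⟩
    push_cast; ring
  have hm := eps_mem K ε hε L l₀ hεL hεl₀
  induction n with
  | zero => simp
  | succ n ih =>
    intro x hx
    rw [← ih x hx, ← h1 _ ((hm n x).1 hx), ← mul_assoc, ← zpow_one_add₀ hε, add_comm 1]
  | pred n ih =>
    intro x hx
    rw [← ih x hx, ← h1 _ ((hm _ x).1 hx), ← mul_assoc, ← zpow_one_add₀ hε]
    congr! 4; ring

/-- Proposition 2.6, Hecke's averaging formula: for a real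
quadratic field `K ⊂ ℝ` with conjugation `σ`, a pseudolattice `L = ℤl₁ + ℤl₂ ⊂ K`,
shifts `l₀, m₀ ∈ K`, weights `η = η₀ + iη₁`, and a totally positive unit `ε > 1`
preserving all the data, the indefinite theta series over a set `S` of
representatives of the `ε`-orbits on `l₀ + L` equals
`√(−iv) ∫_{−log ε}^{log ε} θ_{Λ_t}(...) dt`, where the integrand is the theta series
of the complex lattice `Λ_t(L)`. -/
theorem stmt_13 (K : IntermediateField ℚ ℝ) (hK2 : Module.finrank ℚ K = 2)
    (σ : K ≃+* K) (hσ : ∃ x : K, σ x ≠ x)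
    (l₁ l₂ : K) (hli : LinearIndependent ℚ ![(l₁ : ℝ), (l₂ : ℝ)])
    (l₀ m₀ : K) (η₀ η₁ : ℝ) (ε : K)
    (hε1 : 1 < (ε : ℝ)) (hεnorm : ε * σ ε = 1)
    (hεL : ∀ l : K, l ∈ AddSubgroup.closure {l₁, l₂} ↔ ε * l ∈ AddSubgroup.closure {l₁, l₂})
    (hεl₀ : (ε - 1) * l₀ ∈ AddSubgroup.closure {l₁, l₂})
    (hchar1 : ∀ l ∈ AddSubgroup.closure {l₁, l₂},
      ∃ n : ℤ, trK K σ ((ε - 1) * l * σ m₀) = (n : ℝ))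
    (hchar2 : ∃ n : ℤ, trK K σ ((ε - 1) * l₀ * σ m₀) = ((2 * n : ℤ) : ℝ))
    (S : Set K)
    (hSsub : S ⊆ {x : K | ∃ l ∈ AddSubgroup.closure {l₁, l₂}, x = l₀ + l})
    (hSrep : ∀ x : K, (∃ l ∈ AddSubgroup.closure {l₁, l₂}, x = l₀ + l) →
      ∃! y : K, y ∈ S ∧ ∃ n : ℤ, y = ε ^ n * x)
    (v : ℂ) (hv : 0 < v.im) :
    let L : AddSubgroup K := AddSubgroup.closure {l₁, l₂}
    let outer : K → ℂ := fun x =>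
      ((η₀ * Real.sign ((σ x : ℝ)) + η₁ * Real.sign ((x : ℝ)) : ℝ) : ℂ) *
        Complex.exp (2 * (π : ℂ) * Complex.I * v * ((|(x : ℝ) * (σ x : ℝ)| : ℝ) : ℂ)) *
        Complex.exp (-2 * (π : ℂ) * Complex.I * ((trK K σ ((x - l₀) * σ m₀) : ℝ) : ℂ)) *
        Complex.exp (-(π : ℂ) * Complex.I * ((trK K σ (l₀ * σ m₀) : ℝ) : ℂ))
    let inner : ℝ → K → ℂ := fun t l =>
      ((((lamt K σ t (l₀ + l)) * ((η₀ : ℂ) + Complex.I * (η₁ : ℂ))).im : ℝ) : ℂ) *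
        Complex.exp ((π : ℂ) * Complex.I * v *
          ((Complex.normSq (lamt K σ t (l₀ + l)) : ℝ) : ℂ)) *
        Complex.exp (-2 * (π : ℂ) * Complex.I * ((trK K σ (l * σ m₀) : ℝ) : ℂ)) *
        Complex.exp (-(π : ℂ) * Complex.I * ((trK K σ (l₀ * σ m₀) : ℝ) : ℂ))
    Summable (fun x : S => ‖outer (x : K)‖) ∧
    (∀ t : ℝ, Summable (fun l : L => ‖inner t (l : K)‖)) ∧
    IntervalIntegrable (fun t : ℝ => ∑' l : L, inner t (l : K)) MeasureTheory.volume
      (-Real.log (ε : ℝ)) (Real.log (ε : ℝ)) ∧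
    (∑' x : S, outer (x : K)) =
      (-Complex.I * v) ^ ((1 : ℂ) / 2) *
        ∫ t in (-Real.log (ε : ℝ))..(Real.log (ε : ℝ)), ∑' l : L, inner t (l : K) := by
  intro L outer inner
  have hDet := det_ne K hK2 σ hσ l₁ l₂ hli
  have hε0r : (0 : ℝ) < ε := by linarith
  have hε0 : ε ≠ 0 := by
    intro h; rw [h] at hε0r; simp at hε0r
  set ℓ := Real.log (ε : ℝ) with hℓdef
  have hℓ : 0 < ℓ := Real.log_pos hε1
  set a : ℂ := -(π : ℂ) * Complex.I * v with hadef
  have ha : 0 < a.re := by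
    have : a.re = π * v.im := by simp [hadef]
    rw [this]; exact mul_pos Real.pi_pos hv
  set G : ℝ → K → ℂ := fun t x => GG a η₀ η₁ (x : ℝ) (σ x : ℝ) t with hGdef
  set χ : K → ℂ := chi K σ l₀ m₀ with hχdef
  have hχ1 : ∀ l, ‖χ l‖ = 1 := chi_norm K σ l₀ m₀
  have hinner : ∀ t l, inner t l = G t (l₀ + l) * χ l := by
    intro t l
    have e1 : (lamt K σ t (l₀ + l)).re = ((l₀ + l : K) : ℝ) * Real.exp (t / 2) := by
      unfold lamt
      simp only [Complex.add_re, Complex.ofReal_re, Complex.I_mul_re, Complex.ofReal_im, neg_zero,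
        add_zero]
    have e2 : (lamt K σ t (l₀ + l)).im = ((σ (l₀ + l) : K) : ℝ) * Real.exp (-t / 2) := by
      unfold lamt
      simp only [Complex.add_im, Complex.ofReal_re, Complex.I_mul_im, Complex.ofReal_im, zero_add]
    have e3 : (lamt K σ t (l₀ + l) * ((η₀ : ℂ) + Complex.I * (η₁ : ℂ))).im =
        η₁ * (((l₀ + l : K) : ℝ) * Real.exp (t / 2)) +
          η₀ * (((σ (l₀ + l) : K) : ℝ) * Real.exp (-t / 2)) := by
      rw [Complex.mul_im, e1, e2]
      simp only [Complex.add_im, Complex.add_re, Complex.ofReal_re, Complex.I_mul_im,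
        Complex.I_mul_re, Complex.ofReal_im]
      ring
    have x1 : Real.exp (t / 2) * Real.exp (t / 2) = Real.exp t := by
      rw [← Real.exp_add]; congr 1; ring
    have x2 : Real.exp (-t / 2) * Real.exp (-t / 2) = Real.exp (-t) := by
      rw [← Real.exp_add]; congr 1; ring
    have e4 : Complex.normSq (lamt K σ t (l₀ + l)) =
        ((l₀ + l : K) : ℝ) ^ 2 * Real.exp t + ((σ (l₀ + l) : K) : ℝ) ^ 2 * Real.exp (-t) := by
      rw [Complex.normSq_apply, e1, e2, ← x1, ← x2]; ring
    simp only [inner, hGdef, hχdef, GG, chi]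
    rw [e3, e4, mul_assoc]
    congr 3
    rw [hadef]; ring
  have houter : ∀ x, outer x = ((η₀ * Real.sign ((σ x : ℝ)) + η₁ * Real.sign ((x : ℝ)) : ℝ) : ℂ) *
        Complex.exp (-2 * a * ((|(x : ℝ) * (σ x : ℝ)| : ℝ) : ℂ)) * χ (x - l₀) := by
    intro x
    simp only [outer, hχdef, chi]
    rw [mul_assoc]
    congr 3
    rw [hadef]; ring
  -- the bound
  have hsumL : ∀ c : ℝ, 0 < c → Summable (fun l : L =>
      Real.exp (-c * (((l₀ + (l : K) : K) : ℝ) ^ 2 + ((σ (l₀ + (l : K)) : K) : ℝ) ^ 2))) := by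
    intro c hc
    have hl := lattice_sum (l₀ : ℝ) (σ l₀ : ℝ) (l₁ : ℝ) (σ l₁ : ℝ) (l₂ : ℝ) (σ l₂ : ℝ) c hc hDet
    have hex : ∀ l : L, ∃ mn : ℤ × ℤ, mn.1 • l₁ + mn.2 • l₂ = (l : K) := by
      intro l
      obtain ⟨m, n, h⟩ := AddSubgroup.mem_closure_pair.1 l.2
      exact ⟨(m, n), h⟩
    choose f hf using hex
    have hinj : Function.Injective f := by
      intro x y hxy
      apply Subtype.ext
      rw [← hf x, ← hf y, hxy]
    refine (hl.comp_injective hinj).congr fun l => ?_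
    simp only [Function.comp]
    congr 4
    · rw [← hf l]; push_cast; simp
    · rw [← hf l, map_add, map_add, map_zsmul, map_zsmul]; push_cast; simp
  have : Countable L := by
    have : Function.Surjective (fun mn : ℤ × ℤ => (⟨mn.1 • l₁ + mn.2 • l₂,
      AddSubgroup.mem_closure_pair.2 ⟨_, _, rfl⟩⟩ : L)) := by
      intro l
      obtain ⟨m, n, h⟩ := AddSubgroup.mem_closure_pair.1 l.2
      exact ⟨(m, n), Subtype.ext h⟩
    exact this.countable
  have hbound : ∀ T : ℝ, ∃ u : L → ℝ, Summable u ∧ ∀ (l : L) t, |t| ≤ T → ‖inner t l‖ ≤ u l := by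
    intro T
    obtain ⟨C, c, hc, hB⟩ := GG_bound a ha η₀ η₁ T
    refine ⟨_, (hsumL c hc).mul_left C, fun l t ht => ?_⟩
    rw [hinner, norm_mul, hχ1, mul_one]
    exact hB _ _ t ht
  have hcont : ∀ l, Continuous fun t => inner t l := by
    intro l
    simp_rw [hinner]
    exact (GG_cont _ _ _ _ _).mul continuous_const
  have hS2 : ∀ t : ℝ, Summable (fun l : L => ‖inner t (l : K)‖) := by
    intro t
    obtain ⟨u, hu, hb⟩ := hbound |t|
    exact Summable.of_nonneg_of_le (fun _ => norm_nonneg _) (fun l => hb l t le_rfl) hu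
  obtain ⟨u, hu, hub⟩ := hbound ℓ
  have hIcc : ∀ t ∈ Set.uIcc (-ℓ) ℓ, |t| ≤ ℓ := by
    intro t ht
    rw [Set.uIcc_of_le (by linarith)] at ht
    exact abs_le.2 ht
  have hS3 : IntervalIntegrable (fun t : ℝ => ∑' l : L, inner t (l : K)) MeasureTheory.volume (-ℓ) ℓ := by
    apply ContinuousOn.intervalIntegrable
    exact continuousOn_tsum (fun l => (hcont l).continuousOn) hu (fun l t ht => hub l t (hIcc t ht))
  set h : L → ℂ := fun l => ∫ t in (-ℓ)..ℓ, inner t (l : K) with hhdef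
  have hsum : HasSum h (∫ t in (-ℓ)..ℓ, ∑' l : L, inner t (l : K)) := by
    refine intervalIntegral.hasSum_integral_of_dominated_convergence (fun l _ => u l)
      (fun l => (hcont l).aestronglyMeasurable) ?_ ?_ ?_ ?_
    · intro l
      refine Filter.Eventually.of_forall fun t ht => hub l t (hIcc t (Set.uIoc_subset_uIcc ht))
    · exact Filter.Eventually.of_forall fun t _ => hu
    · exact intervalIntegrable_const
    · exact Filter.Eventually.of_forall fun t _ => (hS2 t).of_norm.hasSum
  have hnsum : Summable fun l => ‖h l‖ := by
    refine Summable.of_nonneg_of_le (fun _ => norm_nonneg _) (fun l => ?_) (hu.mul_right |ℓ - (-ℓ)|)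
    exact intervalIntegral.norm_integral_le_of_norm_le_const
      (fun t ht => hub l t (hIcc t (Set.uIoc_subset_uIcc ht)))
  -- orbits
  set S' := {s : S // (s : K) ≠ 0} with hS'
  have hSmem : ∀ s : S, (s : K) - l₀ ∈ L := by
    intro s
    obtain ⟨l, hl, e⟩ := hSsub s.2
    rw [e, add_sub_cancel_left]; exact hl
  have hmem := eps_mem K ε hε0 L l₀ hεL hεl₀
  have hchi := chi_inv K σ ε hε0 L l₀ m₀ hεL hεl₀ hchar1 hchar2
  set φ : S' × ℤ → L := fun y => ⟨ε ^ y.2 * (y.1.1 : K) - l₀, (hmem y.2 _).1 (hSmem y.1.1)⟩ with hφ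
  have hφinj : Function.Injective φ := by
    rintro ⟨⟨⟨s, hs⟩, hs0⟩, n⟩ ⟨⟨⟨s', hs'⟩, hs0'⟩, n'⟩ hE
    have hE' : ε ^ n * s = ε ^ n' * s' := by
      have := congrArg (fun z : L => (z : K) + l₀) hE
      simpa [hφ] using this
    have hss : s = s' := by
      obtain ⟨y, -, hy⟩ := hSrep s (hSsub hs)
      have h1 := hy s ⟨hs, 0, by simp⟩
      have h2 := hy s' ⟨hs', n - n', by
        rw [zpow_sub₀ hε0, div_mul_eq_mul_div, hE', mul_div_cancel_left₀ _ (zpow_ne_zero _ hε0)]⟩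
      rw [h1, h2]
    subst hss
    have hnn : ε ^ n = ε ^ n' := mul_right_cancel₀ hs0 hE'
    have hnn' : (ε : ℝ) ^ n = (ε : ℝ) ^ n' := by
      have e : ∀ k : ℤ, ((ε ^ k : K) : ℝ) = (ε : ℝ) ^ k := fun k => map_zpow₀ K.val ε k
      rw [← e n, ← e n', hnn]
    have : n = n' := (zpow_right_strictMono₀ hε1).injective hnn'
    rw [this]
  have hφrange : ∀ l : L, l ∉ Set.range φ → h l = 0 := by
    intro l hl
    have hz : l₀ + (l : K) = 0 := by
      by_contra hne
      apply hl
      obtain ⟨y, ⟨hyS, n, hyn⟩, -⟩ := hSrep (l₀ + (l : K)) ⟨l, l.2, rfl⟩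
      refine ⟨(⟨⟨y, hyS⟩, ?_⟩, -n), ?_⟩
      · show y ≠ 0
        rw [hyn]; exact mul_ne_zero (zpow_ne_zero _ hε0) hne
      · apply Subtype.ext
        simp only [hφ, hyn]
        rw [← mul_assoc, ← zpow_add₀ hε0]; simp
    have : ∀ t, inner t (l : K) = 0 := by
      intro t
      rw [hinner, hz]; simp [hGdef, GG]
    simp [hhdef, this]
  have hsumφ := (hφinj.hasSum_iff hφrange).2 hsum
  have hnsumφ : Summable fun y => ‖h (φ y)‖ := hnsum.comp_injective hφinj
  have hsq : (-Complex.I * v) ^ ((1 : ℂ) / 2) * (π / a) ^ (1 / 2 : ℂ) = 1 := by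
    have hπ : (π : ℂ) ≠ 0 := by exact_mod_cast Real.pi_ne_zero
    have hre : 0 < (-Complex.I * v).re := by simpa using hv
    have hw : (-Complex.I * v) ≠ 0 := by intro h; rw [h] at hre; simp at hre
    have e : (π : ℂ) / a = (-Complex.I * v)⁻¹ := by
      rw [show a = π * (-Complex.I * v) by rw [hadef]; ring, div_mul_eq_div_div, div_self hπ, one_div]
    rw [e, Complex.inv_cpow _ _ (by
      have := Complex.abs_arg_lt_pi_div_two_iff.2 (Or.inl hre)
      intro h; rw [h, abs_of_pos Real.pi_pos] at this; linarith [Real.pi_pos])]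
    exact mul_inv_cancel₀ (by rw [Complex.cpow_ne_zero_iff]; exact Or.inl hw)
  set R := (-Complex.I * v) ^ ((1 : ℂ) / 2) with hR
  have hfib : ∀ s : S', HasSum (fun n : ℤ => R * h (φ (s, n))) (outer (s.1 : K)) := by
    intro s
    set x : K := (s.1 : K) with hx
    have hx0 : (x : ℝ) ≠ 0 := by
      have := s.2; intro h0; exact this (Subtype.ext h0)
    have hx1 : ((σ x : K) : ℝ) ≠ 0 := by
      have := s.2; intro h0
      exact this ((map_eq_zero σ).1 (Subtype.ext h0))
    obtain ⟨hi, hI⟩ := GG_int a ha η₀ η₁ (x : ℝ) (σ x : ℝ) hx0 hx1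
    have hun := ((GG_unfold a η₀ η₁ (x : ℝ) (σ x : ℝ) ℓ hℓ hi).mul_right (χ (x - l₀))).mul_left R
    rw [hI] at hun
    have e1 : outer x = R * (((η₀ * Real.sign ((σ x : ℝ)) + η₁ * Real.sign ((x : ℝ)) : ℝ) : ℂ) *
        ((π / a) ^ (1 / 2 : ℂ) * Complex.exp (-2 * a * ((|(x : ℝ) * (σ x : ℝ)| : ℝ) : ℂ))) *
        χ (x - l₀)) := by
      rw [houter]
      linear_combination (-((η₀ * Real.sign ((σ x : ℝ)) + η₁ * Real.sign ((x : ℝ)) : ℝ) : ℂ) *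
        Complex.exp (-2 * a * ((|(x : ℝ) * (σ x : ℝ)| : ℝ) : ℂ)) * χ (x - l₀)) * hsq
    have e2 : ∀ n : ℤ, h (φ (s, n)) = (∫ t in (-ℓ)..ℓ,
        GG a η₀ η₁ (Real.exp (n * ℓ) * (x : ℝ)) (Real.exp (-(n * ℓ)) * (σ x : ℝ)) t) *
          χ (x - l₀) := by
      intro n
      have hr := eps_real K σ ε hε1 hεnorm n x
      have hc := hchi n x (hSmem s.1)
      show (∫ t in (-ℓ)..ℓ, inner t (ε ^ n * x - l₀)) = _
      simp_rw [hinner]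
      rw [intervalIntegral.integral_mul_const, add_sub_cancel, hχdef, hc]
      simp only [hGdef]
      rw [hr.1, hr.2]
    rw [e1]
    simp_rw [e2]
    exact hun
  have houter0 : ∀ s : S, s ∉ Set.range (Subtype.val : S' → S) → outer (s : K) = 0 := by
    intro s hs
    have : (s : K) = 0 := by
      by_contra hne
      exact hs ⟨⟨s, hne⟩, rfl⟩
    rw [houter, this]; simp
  have hA := (hsumφ.mul_left R).prod_fiberwise hfib
  have hfin : HasSum (fun s : S => outer (s : K)) (R * ∫ t in (-ℓ)..ℓ, ∑' l : L, inner t (l : K)) :=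
    (Subtype.val_injective.hasSum_iff houter0).1 hA
  have hnormS' : Summable (fun s : S' => ‖outer (s.1 : K)‖) := by
    have hP := (hnsumφ.mul_left ‖R‖)
    refine Summable.of_nonneg_of_le (fun _ => norm_nonneg _) (fun s => ?_) hP.prod
    rw [← (hfib s).tsum_eq]
    have := hP.prod_factor s
    simp_rw [← norm_mul] at this ⊢
    exact norm_tsum_le_tsum_norm this
  refine ⟨?_, hS2, hS3, hfin.tsum_eq⟩
  refine (Subtype.val_injective.summable_iff (f := fun s : S => ‖outer (s : K)‖) ?_).1 hnormS'
  intro s hs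
  rw [houter0 s hs, norm_zero]
end

section
/- Let Λ ⊂ ℂ be a lattice (a free rank-2 discrete additive subgroup spanning ℂ over ℝ), let V > 0 be its covolume with respect to Lebesgue measure on ℂ ≅ ℝ², and let Λ^! := {μ ∈ ℂ : (λ·μ) ∈ ℤ for all λ ∈ Λ} be its dual with respect to the pairing (x·y) = Im(xy). Then for all λ₀, μ₀ ∈ ℂ, all η ∈ ℂ, and all v ∈ ℂ with Im v > 0: Σ_{λ ∈ Λ} ((λ₀+λ)·η)·e^{πi·v·|λ₀+λ|²}·e^{−2πi·(λ·μ₀) − πi·(λ₀·μ₀)} = (i/(V·v²))·Σ_{μ ∈ Λ^!} ((μ₀+μ)·(i·conj(η)))·e^{−(πi/v)·|μ₀+μ|²}·e^{2πi·(λ₀·μ) + πi·(λ₀·μ₀)}, both series converging absolutely. -/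
open Real

lemma aux_summable (α β γ : ℂ) (E : ℤ × ℤ → ℂ) (T S e : ℝ) (hT : 0 < T)
    (h : ∀ x : ℤ × ℤ, (E x).re ≤ -π * (T * (x.1:ℝ)^2 - 2 * S * |(x.1:ℝ)|)
      + -π * (T * (x.2:ℝ)^2 - 2 * S * |(x.2:ℝ)|) + e) :
    Summable (fun x : ℤ × ℤ => (α * x.1 + β * x.2 + γ) * Complex.exp (E x)) := by
  have h0 := summable_pow_mul_jacobiTheta₂_term_bound S hT 0
  have h1 := summable_pow_mul_jacobiTheta₂_term_bound S hT 1
  have h2 : Summable (fun n : ℤ => (1 + |(n:ℝ)|) * Real.exp (-π * (T * (n:ℝ)^2 - 2 * S * |(n:ℝ)|))) := by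
    refine (h0.add h1).congr fun n => ?_
    push_cast; ring
  have h3 := (h2.mul_of_nonneg h2 (fun n => by positivity) (fun n => by positivity)).mul_left
    ((‖α‖ + ‖β‖ + ‖γ‖) * Real.exp e)
  refine h3.of_norm_bounded fun x => ?_
  have e1 : Real.exp ((E x).re) ≤ Real.exp (-π * (T * (x.1:ℝ)^2 - 2 * S * |(x.1:ℝ)|)) *
      Real.exp (-π * (T * (x.2:ℝ)^2 - 2 * S * |(x.2:ℝ)|)) * Real.exp e := by
    rw [← Real.exp_add, ← Real.exp_add]
    exact Real.exp_le_exp.mpr (h x)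
  have e2 : ‖α * x.1 + β * x.2 + γ‖ ≤ (‖α‖ + ‖β‖ + ‖γ‖) * ((1 + |(x.1:ℝ)|) * (1 + |(x.2:ℝ)|)) := by
    have n1 : ‖α * x.1 + β * x.2 + γ‖ ≤ ‖α‖ * |(x.1:ℝ)| + ‖β‖ * |(x.2:ℝ)| + ‖γ‖ := by
      refine (norm_add₃_le).trans ?_
      simp
    have a1 := abs_nonneg (x.1:ℝ)
    have a2 := abs_nonneg (x.2:ℝ)
    have b1 := norm_nonneg α
    have b2 := norm_nonneg β
    have b3 := norm_nonneg γ
    have c12 := mul_nonneg a1 a2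
    nlinarith [mul_nonneg b1 a1, mul_nonneg b1 a2, mul_nonneg b2 a1, mul_nonneg b2 a2, mul_nonneg b3 a1,
      mul_nonneg b3 a2, mul_nonneg b1 c12, mul_nonneg b2 c12, mul_nonneg b3 c12]
  rw [norm_mul, Complex.norm_exp]
  calc _ ≤ _ := mul_le_mul e2 e1 (Real.exp_nonneg _) (by positivity)
    _ = _ := by ring

lemma aux_lin (p x S : ℝ) (h : |p| ≤ S) : 2 * π * (p * x) ≤ 2 * π * (S * |x|) := by
  have : p * x ≤ S * |x| := (le_abs_self _).trans (by rw [abs_mul]; gcongr)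
  have := Real.pi_pos
  nlinarith

/-- summability of a two-dimensional Gaussian -/
lemma aux_summable_gauss (α β γ : ℂ) (A B C : ℝ) (hA : 0 < A) (hD : 0 < A * C - B^2)
    (s : ℂ) (hs : 0 < s.re) (p q r : ℂ) :
    Summable (fun x : ℤ × ℤ => (α * x.1 + β * x.2 + γ) *
      Complex.exp (-π * s * (A * x.1^2 + 2 * B * x.1 * x.2 + C * x.2^2) + 2 * π * (p * x.1 + q * x.2) + r)) := by
  have hC : 0 < C := by
    by_contra hC
    nlinarith [sq_nonneg B, mul_nonneg hA.le (neg_nonneg.mpr (not_lt.mp hC))]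
  have hAC : 0 < A + C := by positivity
  refine aux_summable α β γ _ (s.re * ((A * C - B^2)/(A + C))) (|p.re| + |q.re|) r.re (by positivity) fun x => ?_
  have h1 := aux_lin p.re x.1 (|p.re| + |q.re|) (by linarith [abs_nonneg q.re])
  have h2 := aux_lin q.re x.2 (|p.re| + |q.re|) (by linarith [abs_nonneg p.re])
  have hE : (-π * s * (A * x.1^2 + 2 * B * x.1 * x.2 + C * x.2^2) + 2 * π * (p * x.1 + q * x.2) + r : ℂ).re
     = -π * s.re * (A * x.1^2 + 2 * B * x.1 * x.2 + C * x.2^2) + 2 * π * (p.re * x.1 + q.re * x.2) + r.re := by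
    have : (-π * s * (A * x.1^2 + 2 * B * x.1 * x.2 + C * x.2^2) + 2 * π * (p * x.1 + q * x.2) + r : ℂ)
     = ((-π * (A * x.1^2 + 2 * B * x.1 * x.2 + C * x.2^2) : ℝ) : ℂ) * s + ((2 * π * x.1 : ℝ) : ℂ) * p +
        ((2 * π * x.2 : ℝ) : ℂ) * q + r := by push_cast; ring
    rw [this]
    simp only [Complex.add_re, Complex.re_ofReal_mul]
    ring
  rw [hE]
  have h3 : (A * C - B^2)/(A + C) * ((x.1:ℝ)^2 + (x.2:ℝ)^2) ≤ A * x.1^2 + 2 * B * x.1 * x.2 + C * x.2^2 := by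
    rw [div_mul_eq_mul_div, div_le_iff₀ hAC]
    nlinarith [sq_nonneg (A * x.1 + B * x.2), sq_nonneg (C * x.2 + B * x.1)]
  have h4 := mul_le_mul_of_nonneg_left h3 (mul_pos Real.pi_pos hs).le
  linarith

/-- one-dimensional identity -/
lemma aux_one (a : ℂ) (ha : 0 < a.re) (α β b : ℂ) :
    ∑' n : ℤ, (α * n + β) * Complex.exp (-π * a * n^2 + 2 * π * b * n) =
    1 / a ^ (1/2 : ℂ) * ∑' k : ℤ, (α * (-Complex.I / a * (k + Complex.I * b)) + β) *
      Complex.exp (-π / a * (k + Complex.I * b)^2) := by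
  have ha0 : a ≠ 0 := fun h => by simp [h] at ha
  have hpi : (π : ℂ) ≠ 0 := by exact_mod_cast Real.pi_ne_zero
  have hI := Complex.I_ne_zero
  set τ : ℂ := Complex.I * a with hτ
  set z : ℂ := -Complex.I * b with hz
  have hτ0 : τ ≠ 0 := mul_ne_zero hI ha0
  have him : 0 < τ.im := by simpa [hτ] using ha
  have him2 : 0 < (-1/τ).im := by
    rw [neg_div, Complex.neg_im, one_div, Complex.inv_im]
    have := Complex.normSq_pos.mpr hτ0
    rw [neg_div, neg_neg]; positivity
  have hτa : -Complex.I * τ = a := by rw [hτ, ← mul_assoc]; simp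
  have t0 := hasSum_jacobiTheta₂_term z him
  have t1 := hasSum_jacobiTheta₂'_term z him
  have u0 := hasSum_jacobiTheta₂_term (z/τ) him2
  have u1 := hasSum_jacobiTheta₂'_term (z/τ) him2
  have f0 := jacobiTheta₂_functional_equation z τ
  have f1 := jacobiTheta₂'_functional_equation z τ
  rw [hτa] at f0 f1
  have L : HasSum (fun n : ℤ => (α * n + β) * Complex.exp (-π * a * n^2 + 2 * π * b * n))
      (α / (2 * π * Complex.I) * jacobiTheta₂' z τ + β * jacobiTheta₂ z τ) := by
    convert! (t1.mul_left (α / (2 * π * Complex.I))).add (t0.mul_left β) using 1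
    funext n
    have e : jacobiTheta₂_term n z τ = Complex.exp (-π * a * n^2 + 2 * π * b * n) := by
      rw [jacobiTheta₂_term]
      congr 1
      rw [hz, hτ]
      linear_combination (π * n ^ 2 * a - 2 * π * n * b : ℂ) * Complex.I_sq
    rw [jacobiTheta₂'_term, e]
    field_simp
  have ex : ∀ k : ℤ, Complex.exp (-π / a * (k + Complex.I * b)^2) =
      Complex.exp (-π * Complex.I * z^2 / τ) * jacobiTheta₂_term k (z/τ) (-1/τ) := by
    intro k
    rw [jacobiTheta₂_term, ← Complex.exp_add]
    congr 1
    rw [hz, hτ]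
    field_simp
    ring
  have R : HasSum (fun k : ℤ => (α * (-Complex.I / a * (k + Complex.I * b)) + β) *
      Complex.exp (-π / a * (k + Complex.I * b)^2))
      (Complex.exp (-π * Complex.I * z^2 / τ) * (α / (2 * π * Complex.I) / τ * (jacobiTheta₂' (z/τ) (-1/τ)
        - 2 * π * Complex.I * z * jacobiTheta₂ (z/τ) (-1/τ)) + β * jacobiTheta₂ (z/τ) (-1/τ))) := by
    convert! (((u1.sub (u0.mul_left (2 * π * Complex.I * z))).mul_left
      (α / (2 * π * Complex.I) / τ)).add (u0.mul_left β)).mul_left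
        (Complex.exp (-π * Complex.I * z^2 / τ)) using 1
    funext k
    rw [ex k, jacobiTheta₂'_term]
    have e : -Complex.I / a * (k + Complex.I * b) = (k - z) / τ := by
      rw [hz, hτ]
      field_simp
      ring_nf
      simp only [Complex.I_sq, Complex.I_pow_three]
      ring
    rw [e]
    field_simp
  rw [L.tsum_eq, R.tsum_eq, f0, f1]
  ring

lemma aux_summable_gauss_dual (α β γ : ℂ) (A B C V : ℝ) (hA : 0 < A) (hV : 0 < V) (hD : A * C - B^2 = V^2)
    (s : ℂ) (hs : 0 < s.re) (p q : ℂ) :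
    Summable (fun x : ℤ × ℤ => (γ - Complex.I / (s * V^2) *
        (α * (C * (x.1 + Complex.I * p) - B * (x.2 + Complex.I * q)) +
          β * (A * (x.2 + Complex.I * q) - B * (x.1 + Complex.I * p)))) *
      Complex.exp (-π / (s * V^2) * (C * (x.1 + Complex.I * p)^2
        - 2 * B * (x.1 + Complex.I * p) * (x.2 + Complex.I * q) + A * (x.2 + Complex.I * q)^2))) := by
  have hs0 : s ≠ 0 := fun h => by simp [h] at hs
  have hA0 : (A : ℂ) ≠ 0 := by exact_mod_cast hA.ne'
  have hV0 : (V : ℂ) ≠ 0 := by exact_mod_cast hV.ne'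
  have hinv : 0 < (s⁻¹).re := by
    rw [Complex.inv_re]
    have := Complex.normSq_pos.mpr hs0
    positivity
  have hC : 0 < C := by
    by_contra hC
    nlinarith [sq_nonneg B, mul_nonneg hA.le (neg_nonneg.mpr (not_lt.mp hC)), pow_pos hV 2]
  refine (aux_summable_gauss (-Complex.I / (s * V^2) * (α * C - β * B))
    (-Complex.I / (s * V^2) * (β * A - α * B))
    (γ - Complex.I / (s * V^2) *
      (α * (C * (Complex.I * p) - B * (Complex.I * q)) +
        β * (A * (Complex.I * q) - B * (Complex.I * p)))) (C/V^2) (-B/V^2) (A/V^2) (by positivity)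
        (by
          have : C / V^2 * (A/V^2) - (-B/V^2)^2 = (A * C - B^2) / V^4 := by field_simp
          rw [this, hD]; positivity) s⁻¹ hinv
        (-1 / (s * V^2) * Complex.I * (C * p - B * q)) (-1 / (s * V^2) * Complex.I * (A * q - B * p))
        (-π / (s * V^2) * (C * (Complex.I * p)^2
      - 2 * B * (Complex.I * p) * (Complex.I * q) + A * (Complex.I * q)^2))).congr fun x => ?_
  congr 1
  · ring
  · congr 1
    push_cast
    field_simp
    ring

lemma aux_two (α β γ : ℂ) (A B C V : ℝ) (hA : 0 < A) (hV : 0 < V) (hD : A * C - B^2 = V^2)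
    (s : ℂ) (hs : 0 < s.re) (p q : ℂ) :
    ∑' x : ℤ × ℤ, (α * x.1 + β * x.2 + γ) *
      Complex.exp (-π * s * (A * x.1^2 + 2 * B * x.1 * x.2 + C * x.2^2) + 2 * π * (p * x.1 + q * x.2)) =
    1 / (s * V) * ∑' x : ℤ × ℤ, (γ - Complex.I / (s * V^2) *
        (α * (C * (x.1 + Complex.I * p) - B * (x.2 + Complex.I * q)) +
          β * (A * (x.2 + Complex.I * q) - B * (x.1 + Complex.I * p)))) *
      Complex.exp (-π / (s * V^2) * (C * (x.1 + Complex.I * p)^2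
        - 2 * B * (x.1 + Complex.I * p) * (x.2 + Complex.I * q) + A * (x.2 + Complex.I * q)^2)) := by
  have hs0 : s ≠ 0 := fun h => by simp [h] at hs
  have hA0 : (A : ℂ) ≠ 0 := by exact_mod_cast hA.ne'
  have hV0 : (V : ℂ) ≠ 0 := by exact_mod_cast hV.ne'
  have hDc : (A * C - B^2 : ℂ) = V^2 := by exact_mod_cast hD
  have hCc : (C : ℂ) = (V^2 + B^2) / A := by rw [← hDc]; field_simp; ring
  have hinv : 0 < (s⁻¹).re := by
    rw [Complex.inv_re]
    have := Complex.normSq_pos.mpr hs0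
    positivity
  -- summability of left side
  have S1 := aux_summable_gauss α β γ A B C hA (by rw [hD]; positivity) s hs p q 0
  simp only [add_zero] at S1
  -- summability of right side
  have S2 := aux_summable_gauss_dual α β γ A B C V hA hV hD s hs p q
  -- the middle function
  set F : ℤ × ℤ → ℂ := fun x => ((-Complex.I * α / (s * A)) * x.1 + (β - α * B / A) * x.2 +
      (γ + α * p / (s * A))) *
    Complex.exp (-π / (s * A) * (x.1 + Complex.I * p)^2 + 2 * π * Complex.I * (B / A) * x.2 * (x.1 + Complex.I * p)
      - π * (s * (V^2 / A)) * x.2^2 + 2 * π * q * x.2) with hF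
  have SF : Summable F := by
    refine aux_summable _ _ _ _ (min ((s⁻¹).re / A) (s.re * (V^2/A))) 
      (|(-Complex.I * p * s⁻¹ / A).re| + |(q - B / A * p).re|) ((π / (s * A) * p^2 : ℂ).re)
      (by positivity) fun x => ?_
    have h1 := aux_lin _ x.1 (|(-Complex.I * p * s⁻¹ / A).re| + |(q - B / A * p).re|) (le_add_of_nonneg_right (abs_nonneg _))
    have h2 := aux_lin _ x.2 (|(-Complex.I * p * s⁻¹ / A).re| + |(q - B / A * p).re|) (le_add_of_nonneg_left (abs_nonneg _))
    have : (-π / (s * A) * (x.1 + Complex.I * p)^2 + 2 * π * Complex.I * (B / A) * x.2 * (x.1 + Complex.I * p)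
      - π * (s * (V^2 / A)) * x.2^2 + 2 * π * q * x.2 : ℂ) =
      ((-π * (x.1:ℝ)^2 / A : ℝ) : ℂ) * s⁻¹ + ((-π * (x.2:ℝ)^2 * (V^2/A) : ℝ) : ℂ) * s
       + ((2 * π * (x.1:ℝ) : ℝ) : ℂ) * (-Complex.I * p * s⁻¹ / A)
       + ((2 * π * (x.2:ℝ) : ℝ) : ℂ) * (q - B / A * p) + (π / (s * A) * p^2 : ℂ)
       + ((2 * π * (B/A) * (x.2:ℝ) * (x.1:ℝ) : ℝ) : ℂ) * Complex.I := by
      push_cast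
      field_simp
      ring_nf
      simp only [Complex.I_sq]
      ring
    rw [this]
    simp only [Complex.add_re, Complex.re_ofReal_mul, Complex.I_re]
    have m1 := mul_le_mul_of_nonneg_right (min_le_left ((s⁻¹).re / A) (s.re * (V^2/A))) (mul_nonneg Real.pi_pos.le (sq_nonneg (x.1:ℝ)))
    have m2 := mul_le_mul_of_nonneg_right (min_le_right ((s⁻¹).re / A) (s.re * (V^2/A))) (mul_nonneg Real.pi_pos.le (sq_nonneg (x.2:ℝ)))
    have k1 : -π * (x.1:ℝ)^2 / A * (s⁻¹).re = - ((s⁻¹).re / A * (π * (x.1:ℝ)^2)) := by ring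
    rw [k1]
    linarith
  -- inner sums
  have I1 : ∀ n : ℤ, ∑' m : ℤ, (α * m + β * n + γ) *
      Complex.exp (-π * s * (A * m^2 + 2 * B * m * n + C * n^2) + 2 * π * (p * m + q * n)) =
      1 / (s * A) ^ (1/2 : ℂ) * ∑' k : ℤ, F (k, n) := by
    intro n
    have h := aux_one (s * A) (by rw [Complex.re_mul_ofReal]; positivity) α (β * n + γ) (p - s * B * n)
    have h' := congrArg (fun t => t * Complex.exp (-π * s * C * n^2 + 2 * π * q * n)) h
    rw [← tsum_mul_right, mul_assoc (1 / _), ← tsum_mul_right] at h'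
    convert h' using 1
    · refine tsum_congr fun m => ?_
      rw [mul_assoc _ (Complex.exp _) (Complex.exp _), ← Complex.exp_add]
      congr 1
      · ring
      · congr 1; ring
    · congr 1
      refine tsum_congr fun k => ?_
      rw [mul_assoc _ (Complex.exp _) (Complex.exp _), ← Complex.exp_add]
      simp only [hF]
      congr 1
      · field_simp
        ring_nf
        simp only [Complex.I_sq]
        ring
      · congr 1
        rw [hCc]
        field_simp
        ring_nf
        simp only [Complex.I_sq]
        ring
  have I2 : ∀ k : ℤ, ∑' n : ℤ, F (k, n) = 1 / (s * (V^2 / A : ℝ)) ^ (1/2 : ℂ) * ∑' l : ℤ,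
      (γ - Complex.I / (s * V^2) *
        (α * (C * (k + Complex.I * p) - B * (l + Complex.I * q)) +
          β * (A * (l + Complex.I * q) - B * (k + Complex.I * p)))) *
      Complex.exp (-π / (s * V^2) * (C * (k + Complex.I * p)^2
        - 2 * B * (k + Complex.I * p) * (l + Complex.I * q) + A * (l + Complex.I * q)^2)) := by
    intro k
    have h := aux_one (s * (V^2 / A : ℝ)) (by rw [Complex.re_mul_ofReal]; positivity) (β - α * B / A)
      ((-Complex.I * α / (s * A)) * k + (γ + α * p / (s * A))) (q + Complex.I * (B / A) * (k + Complex.I * p))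
    have h' := congrArg (fun t => t * Complex.exp (-π / (s * A) * (k + Complex.I * p)^2)) h
    rw [← tsum_mul_right, mul_assoc (1 / _), ← tsum_mul_right] at h'
    convert h' using 1
    · refine tsum_congr fun m => ?_
      rw [mul_assoc _ (Complex.exp _) (Complex.exp _), ← Complex.exp_add]
      simp only [hF]
      congr 1
      · ring
      · congr 1; push_cast; ring
    · congr 1
      refine tsum_congr fun l => ?_
      rw [mul_assoc _ (Complex.exp _) (Complex.exp _), ← Complex.exp_add]
      have e : (l + Complex.I * (q + Complex.I * (B / A) * (k + Complex.I * p)) : ℂ) =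
        (l + Complex.I * q) - B / A * (k + Complex.I * p) := by
        linear_combination (B / A * (k + Complex.I * p) : ℂ) * Complex.I_sq
      have e3 : (-Complex.I * α / (s * A)) * k + (γ + α * p / (s * A)) =
        γ - Complex.I * α / (s * A) * (k + Complex.I * p) := by
        linear_combination (α * p / (s * A) : ℂ) * Complex.I_sq
      rw [e, e3]
      generalize (k + Complex.I * p : ℂ) = P
      generalize (l + Complex.I * q : ℂ) = Q
      rw [hCc]
      push_cast
      congr 1
      · field_simp
        ring
      · congr 1
        field_simp
        ring
  have hroot : (s * A) ^ (1/2 : ℂ) * (s * (V^2 / A : ℝ)) ^ (1/2 : ℂ) = s * V := by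
    have hq : 0 < V^2 / A := by positivity
    have hq0 : ((V^2 / A : ℝ) : ℂ) ≠ 0 := by exact_mod_cast hq.ne'
    rw [Complex.cpow_def_of_ne_zero (mul_ne_zero hs0 hA0), Complex.cpow_def_of_ne_zero (mul_ne_zero hs0 hq0),
      mul_comm s, mul_comm s, Complex.log_ofReal_mul hA hs0, Complex.log_ofReal_mul hq hs0, ← Complex.exp_add]
    have hl : Real.log (V^2 / A) = 2 * Real.log V - Real.log A := by
      rw [Real.log_div (by positivity) hA.ne', Real.log_pow]; norm_num
    rw [hl]
    have : (((Real.log A : ℝ) : ℂ) + Complex.log s) * (1/2) +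
      (((2 * Real.log V - Real.log A : ℝ) : ℂ) + Complex.log s) * (1/2) = Complex.log s + (Real.log V : ℝ) := by
      push_cast; ring
    rw [this, Complex.exp_add, Complex.exp_log hs0, ← Complex.ofReal_exp, Real.exp_log hV]
  have S1' := (Equiv.prodComm ℤ ℤ).summable_iff.mpr S1
  simp only [Function.comp_def] at S1'
  rw [← (Equiv.prodComm ℤ ℤ).tsum_eq, Summable.tsum_prod S1']
  simp only [Equiv.prodComm_apply, Prod.swap_prod_mk]
  rw [tsum_congr I1, tsum_mul_left]
  have hcomm : ∑' n : ℤ, ∑' k : ℤ, F (k, n) = ∑' k : ℤ, ∑' n : ℤ, F (k, n) :=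
    (Summable.tsum_comm (f := fun k n => F (k, n)) SF)
  rw [hcomm, tsum_congr I2, tsum_mul_left, Summable.tsum_prod S2, ← mul_assoc, ← hroot]
  congr 1
  field_simp

lemma aux_gram (a₁ b₁ a₂ b₂ u₁ u₂ w₁ w₂ : ℝ) :
    (a₂^2 + b₂^2) * (a₁ * u₁ + b₁ * u₂) * (a₁ * w₁ + b₁ * w₂)
    - (a₁ * a₂ + b₁ * b₂) * ((a₁ * u₁ + b₁ * u₂) * (a₂ * w₁ + b₂ * w₂) +
      (a₂ * u₁ + b₂ * u₂) * (a₁ * w₁ + b₁ * w₂))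
    + (a₁^2 + b₁^2) * (a₂ * u₁ + b₂ * u₂) * (a₂ * w₁ + b₂ * w₂) =
    (a₁ * b₂ - a₂ * b₁)^2 * (u₁ * w₁ + u₂ * w₂) := by ring

lemma aux_det (ω₁ ω₂ : ℂ) (hω : LinearIndependent ℝ ![ω₁, ω₂]) :
    ω₁.re * ω₂.im - ω₂.re * ω₁.im ≠ 0 := by
  intro h
  have h0 := hω.ne_zero 0
  simp only [Matrix.cons_val_zero] at h0
  rw [LinearIndependent.pair_iff] at hω
  have e1 := hω (ω₂.re) (-ω₁.re) (by
    apply Complex.ext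
    · simp; ring
    · simp; linarith)
  have e2 := hω (ω₂.im) (-ω₁.im) (by
    apply Complex.ext
    · simp; linarith
    · simp; ring)
  apply h0
  apply Complex.ext
  · simpa using e1.2
  · simpa using e2.2

lemma aux_lattice_bij (ω₁ ω₂ : ℂ) (hD : ω₁.re * ω₂.im - ω₂.re * ω₁.im ≠ 0) :
    ∃ e : ℤ × ℤ ≃ AddSubgroup.closure ({ω₁, ω₂} : Set ℂ), ∀ x, ((e x : _) : ℂ) = x.1 * ω₁ + x.2 * ω₂ := by
  have hmem : ∀ x : ℤ × ℤ, (x.1 * ω₁ + x.2 * ω₂ : ℂ) ∈ AddSubgroup.closure ({ω₁, ω₂} : Set ℂ) := by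
    intro x
    rw [AddSubgroup.mem_closure_pair]
    exact ⟨x.1, x.2, by simp⟩
  refine ⟨Equiv.ofBijective (fun x => ⟨x.1 * ω₁ + x.2 * ω₂, hmem x⟩) ⟨?_, ?_⟩, fun x => rfl⟩
  · rintro ⟨m, n⟩ ⟨m', n'⟩ h
    have h := congrArg Subtype.val h
    simp only at h
    have hr := congrArg Complex.re h
    have hi := congrArg Complex.im h
    simp at hr hi
    have k1 : ((m:ℝ) - m') * (ω₁.re * ω₂.im - ω₂.re * ω₁.im) = 0 := by
      linear_combination ω₂.im * hr - ω₂.re * hi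
    have k2 : ((n:ℝ) - n') * (ω₁.re * ω₂.im - ω₂.re * ω₁.im) = 0 := by
      linear_combination ω₁.re * hi - ω₁.im * hr
    have k1 := sub_eq_zero.mp ((mul_eq_zero.mp k1).resolve_right hD)
    have k2 := sub_eq_zero.mp ((mul_eq_zero.mp k2).resolve_right hD)
    ext
    · exact_mod_cast k1
    · exact_mod_cast k2
  · rintro ⟨l, hl⟩
    obtain ⟨m, n, h⟩ := AddSubgroup.mem_closure_pair.mp hl
    exact ⟨(m, n), Subtype.ext (by simpa using h)⟩

lemma aux_dual_bij (ω₁ ω₂ : ℂ) (hD : ω₁.re * ω₂.im - ω₂.re * ω₁.im ≠ 0) :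
    ∃ e : ℤ × ℤ ≃ {μ : ℂ | ∀ l ∈ AddSubgroup.closure ({ω₁, ω₂} : Set ℂ), ∃ n : ℤ, (l * μ).im = (n : ℝ)},
      ∀ x, (ω₁ * ((e x : _) : ℂ)).im = x.1 ∧ (ω₂ * ((e x : _) : ℂ)).im = x.2 := by
  set D := ω₁.re * ω₂.im - ω₂.re * ω₁.im with hDdef
  set φ : ℤ × ℤ → ℂ := fun x => ⟨(ω₁.re * x.2 - ω₂.re * x.1) / D, (x.1 * ω₂.im - x.2 * ω₁.im) / D⟩ with hφ
  have h1 : ∀ x, (ω₁ * φ x).im = x.1 := by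
    intro x
    simp only [hφ, Complex.mul_im]
    field_simp
    rw [hDdef]; ring
  have h2 : ∀ x, (ω₂ * φ x).im = x.2 := by
    intro x
    simp only [hφ, Complex.mul_im]
    field_simp
    rw [hDdef]; ring
  have hmem : ∀ x, φ x ∈ {μ : ℂ | ∀ l ∈ AddSubgroup.closure ({ω₁, ω₂} : Set ℂ), ∃ n : ℤ, (l * μ).im = (n : ℝ)} := by
    intro x l hl
    obtain ⟨m, n, h⟩ := AddSubgroup.mem_closure_pair.mp hl
    refine ⟨m * x.1 + n * x.2, ?_⟩
    rw [← h, add_mul, smul_mul_assoc, smul_mul_assoc, Complex.add_im]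
    simp only [zsmul_eq_mul, Complex.mul_im (m:ℂ), Complex.mul_im (n:ℂ), h1, h2]
    simp
  refine ⟨Equiv.ofBijective (fun x => ⟨φ x, hmem x⟩) ⟨?_, ?_⟩, fun x => ⟨h1 x, h2 x⟩⟩
  · intro x y h
    have h := congrArg Subtype.val h
    simp only at h
    have e1 := h1 x
    have e2 := h2 x
    rw [h, h1] at e1
    rw [h, h2] at e2
    ext
    · exact_mod_cast e1.symm
    · exact_mod_cast e2.symm
  · rintro ⟨μ, hμ⟩
    obtain ⟨k, hk⟩ := hμ ω₁ (AddSubgroup.subset_closure (by simp))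
    obtain ⟨l, hl⟩ := hμ ω₂ (AddSubgroup.subset_closure (by simp))
    refine ⟨(k, l), Subtype.ext ?_⟩
    simp only [hφ, Complex.mul_im] at hk hl ⊢
    apply Complex.ext
    · simp only
      rw [← hk, ← hl]
      field_simp
      rw [hDdef]; ring
    · simp only
      rw [← hk, ← hl]
      field_simp
      rw [hDdef]; ring



/-- functional equation (2.24), via Poisson summation: for a
lattice `Λ = ℤω₁ + ℤω₂ ⊂ ℂ` of covolume `V`, with dual
`Λ^! = {μ : (λ·μ) ∈ ℤ ∀ λ ∈ Λ}` for the pairing `(x·y) = Im(xy)`, and all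
`λ₀, μ₀, η ∈ ℂ`, `Im v > 0`:
`Σ_{λ∈Λ} ((λ₀+λ)·η)e^{πiv|λ₀+λ|²}e^{−2πi(λ·μ₀)−πi(λ₀·μ₀)}
 = (i/(V v²)) Σ_{μ∈Λ^!} ((μ₀+μ)·(i·conj η))e^{−(πi/v)|μ₀+μ|²}e^{2πi(λ₀·μ)+πi(λ₀·μ₀)}`,
both series converging absolutely. -/
theorem stmt_17 (ω₁ ω₂ : ℂ) (hω : LinearIndependent ℝ ![ω₁, ω₂])
    (lam₀ mu₀ η v : ℂ) (hv : 0 < v.im) :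
    let Λ : AddSubgroup ℂ := AddSubgroup.closure {ω₁, ω₂}
    let V : ℝ := |ω₁.re * ω₂.im - ω₂.re * ω₁.im|
    let dual : Set ℂ := {μ : ℂ | ∀ l ∈ Λ, ∃ n : ℤ, (l * μ).im = (n : ℝ)}
    let f : ℂ → ℂ := fun l =>
      ((((lam₀ + l) * η).im : ℝ) : ℂ) *
        Complex.exp ((π : ℂ) * Complex.I * v * ((Complex.normSq (lam₀ + l) : ℝ) : ℂ)) *
        Complex.exp (-2 * (π : ℂ) * Complex.I * (((l * mu₀).im : ℝ) : ℂ) -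
          (π : ℂ) * Complex.I * (((lam₀ * mu₀).im : ℝ) : ℂ))
    let g : ℂ → ℂ := fun mu =>
      ((((mu₀ + mu) * (Complex.I * (starRingEnd ℂ) η)).im : ℝ) : ℂ) *
        Complex.exp (-((π : ℂ) * Complex.I / v) * ((Complex.normSq (mu₀ + mu) : ℝ) : ℂ)) *
        Complex.exp (2 * (π : ℂ) * Complex.I * (((lam₀ * mu).im : ℝ) : ℂ) +
          (π : ℂ) * Complex.I * (((lam₀ * mu₀).im : ℝ) : ℂ))
    Summable (fun l : Λ => ‖f (l : ℂ)‖) ∧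
    Summable (fun mu : dual => ‖g (mu : ℂ)‖) ∧
    (∑' l : Λ, f (l : ℂ)) =
      Complex.I / ((V : ℂ) * v ^ 2) * ∑' mu : dual, g (mu : ℂ) := by
  intro Λ V dual f g
  have hD := aux_det ω₁ ω₂ hω
  obtain ⟨e, he⟩ := aux_lattice_bij ω₁ ω₂ hD
  obtain ⟨d, hd⟩ := aux_dual_bij ω₁ ω₂ hD
  have hV : 0 < V := abs_pos.mpr hD
  have hV2 : V^2 = (ω₁.re * ω₂.im - ω₂.re * ω₁.im)^2 := sq_abs _
  set A : ℝ := ω₁.re^2 + ω₁.im^2 with hAdef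
  set B : ℝ := ω₁.re * ω₂.re + ω₁.im * ω₂.im with hBdef
  set C : ℝ := ω₂.re^2 + ω₂.im^2 with hCdef
  have hdisc : A * C - B^2 = V^2 := by rw [hV2, hAdef, hBdef, hCdef]; ring
  have hA : 0 < A := by
    have : 0 ≤ A := by positivity
    rcases this.lt_or_eq with h | h
    · exact h
    · nlinarith [sq_nonneg B, pow_pos hV 2]
  set s : ℂ := -Complex.I * v with hsdef
  have hs : 0 < s.re := by simpa [hsdef] using hv
  have hs0 : s ≠ 0 := fun h => by simp [h] at hs
  have hv0 : v ≠ 0 := fun h => by simp [h] at hv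
  have hVc : (V : ℂ) ≠ 0 := by exact_mod_cast hV.ne'
  have hinv : 0 < (s⁻¹).re := by
    rw [Complex.inv_re]
    have := Complex.normSq_pos.mpr hs0
    positivity
  have hC : 0 < C := by
    by_contra hC
    nlinarith [sq_nonneg B, mul_nonneg hA.le (neg_nonneg.mpr (not_lt.mp hC)), pow_pos hV 2]
  set X : ℝ := ω₁.re * lam₀.re + ω₁.im * lam₀.im with hX
  set Y : ℝ := ω₂.re * lam₀.re + ω₂.im * lam₀.im with hY
  set α : ℝ := (ω₁ * η).im with hα
  set β : ℝ := (ω₂ * η).im with hβ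
  set γ : ℝ := (lam₀ * η).im with hγ
  set x₀ : ℝ := (ω₁ * mu₀).im with hx₀
  set y₀ : ℝ := (ω₂ * mu₀).im with hy₀
  set p : ℂ := -s * X - Complex.I * x₀ with hp
  set q : ℂ := -s * Y - Complex.I * y₀ with hq
  set r : ℂ := -π * s * ((Complex.normSq lam₀ : ℝ) : ℂ) - π * Complex.I * (((lam₀ * mu₀).im : ℝ) : ℂ) with hr
  have hf : ∀ x : ℤ × ℤ, f (e x : ℂ) = ((α : ℂ) * x.1 + β * x.2 + γ) *
      Complex.exp (-π * s * (A * x.1^2 + 2 * B * x.1 * x.2 + C * x.2^2) + 2 * π * (p * x.1 + q * x.2) + r) := by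
    intro x
    simp only [f, he]
    rw [mul_assoc, ← Complex.exp_add]
    have c1 : ((lam₀ + (x.1 * ω₁ + x.2 * ω₂)) * η).im = α * x.1 + β * x.2 + γ := by
      rw [hα, hβ, hγ]; simp; ring
    have c2 : Complex.normSq (lam₀ + (x.1 * ω₁ + x.2 * ω₂)) = Complex.normSq lam₀ +
        2 * (X * x.1 + Y * x.2) + (A * x.1^2 + 2 * B * x.1 * x.2 + C * x.2^2) := by
      rw [hX, hY, hAdef, hBdef, hCdef]; simp [Complex.normSq_apply]; ring
    have c3 : ((x.1 * ω₁ + x.2 * ω₂) * mu₀).im = x₀ * x.1 + y₀ * x.2 := by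
      rw [hx₀, hy₀]; simp; ring
    rw [c1, c2, c3]
    congr 1
    · push_cast; ring
    · congr 1
      rw [hr, hp, hq, hsdef]
      push_cast; ring
  have hg : ∀ x : ℤ × ℤ, Complex.exp r * ((γ - Complex.I / (s * V^2) *
        (α * (C * (x.1 + Complex.I * p) - B * (x.2 + Complex.I * q)) +
          β * (A * (x.2 + Complex.I * q) - B * (x.1 + Complex.I * p)))) *
      Complex.exp (-π / (s * V^2) * (C * (x.1 + Complex.I * p)^2
        - 2 * B * (x.1 + Complex.I * p) * (x.2 + Complex.I * q) + A * (x.2 + Complex.I * q)^2))) =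
      -Complex.I / s * g (d x : ℂ) := by
    intro x
    obtain ⟨d1, d2⟩ := hd x
    simp only [g]
    set μ : ℂ := (d x : ℂ) with hμ
    set a : ℝ := (ω₁ * (mu₀ + μ)).im with ha
    set b : ℝ := (ω₂ * (mu₀ + μ)).im with hb
    have hP : (x.1 + Complex.I * p : ℂ) = a - Complex.I * s * X := by
      have : (a : ℂ) = x.1 + x₀ := by
        rw [ha, mul_add, Complex.add_im, d1, hx₀]; push_cast; ring
      rw [this, hp]
      linear_combination (-x₀ : ℂ) * Complex.I_sq
    have hQ : (x.2 + Complex.I * q : ℂ) = b - Complex.I * s * Y := by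
      have : (b : ℂ) = x.2 + y₀ := by
        rw [hb, mul_add, Complex.add_im, d2, hy₀]; push_cast; ring
      rw [this, hq]
      linear_combination (-y₀ : ℂ) * Complex.I_sq
    rw [hP, hQ]
    set M : ℂ := mu₀ + μ with hM
    -- Gram identities
    have G1 : C * a * α - B * (a * β + b * α) + A * b * β =
        V^2 * (M * (Complex.I * (starRingEnd ℂ) η)).im := by
      have := aux_gram ω₁.re ω₁.im ω₂.re ω₂.im M.im M.re η.im η.re
      rw [hV2, hAdef, hBdef, hCdef, ha, hb, hα, hβ]
      simp only [Complex.mul_im, Complex.mul_re, Complex.I_re, Complex.I_im, Complex.conj_re, Complex.conj_im]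
      linear_combination this
    have G2 : C * X * α - B * (X * β + Y * α) + A * Y * β = V^2 * γ := by
      have := aux_gram ω₁.re ω₁.im ω₂.re ω₂.im lam₀.re lam₀.im η.im η.re
      rw [hV2, hAdef, hBdef, hCdef, hX, hY, hα, hβ, hγ]
      simp only [Complex.mul_im]
      linear_combination this
    have G3 : C * a * a - B * (a * b + b * a) + A * b * b = V^2 * Complex.normSq M := by
      have := aux_gram ω₁.re ω₁.im ω₂.re ω₂.im M.im M.re M.im M.re
      rw [hV2, hAdef, hBdef, hCdef, ha, hb]
      simp only [Complex.mul_im, Complex.normSq_apply]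
      linear_combination this
    have G4 : C * X * X - B * (X * Y + Y * X) + A * Y * Y = V^2 * Complex.normSq lam₀ := by
      have := aux_gram ω₁.re ω₁.im ω₂.re ω₂.im lam₀.re lam₀.im lam₀.re lam₀.im
      rw [hV2, hAdef, hBdef, hCdef, hX, hY]
      simp only [Complex.normSq_apply]
      linear_combination this
    have G5 : C * X * a - B * (X * b + Y * a) + A * Y * b = V^2 * ((lam₀ * mu₀).im + (lam₀ * μ).im) := by
      have := aux_gram ω₁.re ω₁.im ω₂.re ω₂.im lam₀.re lam₀.im M.im M.re
      rw [hV2, hAdef, hBdef, hCdef, hX, hY, ha, hb, ← Complex.add_im, ← mul_add]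
      simp only [Complex.mul_im]
      linear_combination this
    generalize (M * (Complex.I * (starRingEnd ℂ) η)).im = t at G1 ⊢
    generalize Complex.normSq M = NM at G3 ⊢
    have G1 : (C * a * α - B * (a * β + b * α) + A * b * β : ℂ) = V^2 * t := by exact_mod_cast G1
    have G2 : (C * X * α - B * (X * β + Y * α) + A * Y * β : ℂ) = V^2 * γ := by exact_mod_cast G2
    have G3 : (C * a * a - B * (a * b + b * a) + A * b * b : ℂ) = V^2 * NM := by exact_mod_cast G3
    have G4 : (C * X * X - B * (X * Y + Y * X) + A * Y * Y : ℂ) = V^2 * (Complex.normSq lam₀ : ℝ) := by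
      exact_mod_cast G4
    have G5 : (C * X * a - B * (X * b + Y * a) + A * Y * b : ℂ) =
        V^2 * (((lam₀ * mu₀).im : ℝ) + ((lam₀ * μ).im : ℝ)) := by exact_mod_cast G5
    have K1 : (γ - Complex.I / (s * V^2) *
        (α * (C * (a - Complex.I * s * X) - B * (b - Complex.I * s * Y)) +
          β * (A * (b - Complex.I * s * Y) - B * (a - Complex.I * s * X))) : ℂ) = -Complex.I / s * t := by
      have : (α * (C * (a - Complex.I * s * X) - B * (b - Complex.I * s * Y)) +
          β * (A * (b - Complex.I * s * Y) - B * (a - Complex.I * s * X)) : ℂ) =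
          V^2 * t - Complex.I * s * (V^2 * γ) := by
        rw [← G1, ← G2]; ring
      rw [this]
      field_simp
      linear_combination (s * γ) * Complex.I_sq
    have K2 : (-π / (s * V^2) * (C * (a - Complex.I * s * X)^2
        - 2 * B * (a - Complex.I * s * X) * (b - Complex.I * s * Y) + A * (b - Complex.I * s * Y)^2) : ℂ) =
        -π / s * NM + 2 * π * Complex.I * (((lam₀ * mu₀).im : ℝ) + ((lam₀ * μ).im : ℝ))
          + π * s * (Complex.normSq lam₀ : ℝ) := by
      have : (C * (a - Complex.I * s * X)^2
        - 2 * B * (a - Complex.I * s * X) * (b - Complex.I * s * Y) + A * (b - Complex.I * s * Y)^2 : ℂ) =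
        V^2 * NM - 2 * Complex.I * s * (V^2 * (((lam₀ * mu₀).im : ℝ) + ((lam₀ * μ).im : ℝ)))
          - s^2 * (V^2 * (Complex.normSq lam₀ : ℝ)) := by
        rw [← G3, ← G4, ← G5]
        linear_combination (s^2 * (C * X * X - B * (X * Y + Y * X) + A * Y * Y)) * Complex.I_sq
      rw [this]
      field_simp
      ring
    have K3 : (-π / s : ℂ) = -(π * Complex.I / v) := by
      rw [hsdef]
      field_simp
      linear_combination Complex.I_sq
    rw [K1, K2, K3, mul_left_comm, ← Complex.exp_add, mul_assoc _ (Complex.exp _) (Complex.exp _),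
      ← Complex.exp_add, mul_assoc]
    congr 3
    rw [hr]
    push_cast
    ring
  have S1 : Summable (fun x => f (e x : ℂ)) :=
    (aux_summable_gauss α β γ A B C hA (by rw [hdisc]; positivity) s hs p q r).congr fun x => (hf x).symm
  have S2 : Summable (fun x => g (d x : ℂ)) := by
    have h := (aux_summable_gauss_dual α β γ A B C V hA hV hdisc s hs p q).mul_left (Complex.exp r)
    have h := h.congr hg
    exact (summable_mul_left_iff (by simp [hs0])).mp h
  refine ⟨(Equiv.summable_iff e).mp S1.norm, (Equiv.summable_iff d).mp S2.norm, ?_⟩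
  have T1 : ∑' l : Λ, f (l : ℂ) = ∑' x, f (e x : ℂ) := (e.tsum_eq (fun l : Λ => f (l : ℂ))).symm
  have T2 : ∑' mu : dual, g (mu : ℂ) = ∑' x, g (d x : ℂ) := (d.tsum_eq (fun l : dual => g (l : ℂ))).symm
  rw [T1, T2, tsum_congr hf]
  simp only [Complex.exp_add _ r]
  simp only [← mul_assoc _ _ (Complex.exp r)]
  rw [tsum_mul_right, aux_two α β γ A B C V hA hV hdisc s hs p q, mul_assoc, mul_comm _ (Complex.exp r),
    ← tsum_mul_left, tsum_congr hg, tsum_mul_left, ← mul_assoc]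
  congr 1
  have : s^2 = -v^2 := by rw [hsdef]; linear_combination v^2 * Complex.I_sq
  field_simp
  rw [this]
end

section
/- Let K ⊂ ℝ be a real quadratic field with nontrivial automorphism σ and trace Tr(x) = x + σ(x), let L ⊂ K be a pseudolattice with ℤ-basis l₁, l₂, set Δ(L) := |l₁·σ(l₂) − σ(l₁)·l₂| and L^? := {m ∈ K : Tr(σ(l)·m) ∈ ℤ for all l ∈ L}. Let l₀, m₀ ∈ K and η₀, η₁ ∈ ℝ. For a triple (N, a, b) of a pseudolattice N and a, b ∈ K, a set T of representatives for the ε-orbits on a + N, and real parameters (ξ₀, ξ₁), define Θ(N, ξ₀, ξ₁, a, b, T)(v) := Σ_{x ∈ T} (ξ₀·sgn(σ(x)) + ξ₁·sgn(x))·e^{2πi·v·|x·σ(x)|}·e^{−2πi·Tr((x−a)·σ(b))}·e^{−πi·Tr(a·σ(b))}. Assume ε ∈ K satisfies ε > 1, ε·σ(ε) = 1, ε·L = L, ε·L^? = L^?, (ε−1)·l₀ ∈ L, (ε−1)·m₀ ∈ L^?, and the character conditions Tr((ε−1)·l·σ(m₀)) ∈ ℤ for all l ∈ L, Tr((ε−1)·l₀·σ(m₀))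 ∈ 2ℤ, Tr((ε−1)·m·σ(l₀)) ∈ ℤ for all m ∈ L^?, Tr((ε−1)·m₀·σ(l₀)) ∈ 2ℤ. Let S ⊂ l₀ + L and S' ⊂ m₀ + L^? be sets meeting each orbit {ε^n·x : n ∈ ℤ} exactly once. Then for every v ∈ ℂ with Im v > 0 (so that also Im(−1/v) > 0 and all series converge absolutely): Θ(L, η₀, η₁, l₀, m₀, S)(v) = (1/(Δ(L)·v))·Θ(L^?, η₁, η₀, m₀, −l₀, S')(−1/v). -/
open Real

/-- The general term of the indefinite theta function
`Θ(N, ξ₀, ξ₁, a, b, T)(v) = Σ_{x∈T} (ξ₀ sgn σ(x) + ξ₁ sgn x) e^{2πiv|xσ(x)|}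
e^{−2πi Tr((x−a)σ(b))} e^{−πi Tr(aσ(b))}`. -/
noncomputable def thetaTerm (K : IntermediateField ℚ ℝ) (σ : K ≃+* K)
    (ξ₀ ξ₁ : ℝ) (a b : K) (v : ℂ) (x : K) : ℂ :=
  ((ξ₀ * Real.sign ((σ x : ℝ)) + ξ₁ * Real.sign ((x : ℝ)) : ℝ) : ℂ) *
    Complex.exp (2 * (π : ℂ) * Complex.I * v * ((|(x : ℝ) * (σ x : ℝ)| : ℝ) : ℂ)) *
    Complex.exp (-2 * (π : ℂ) * Complex.I * ((trK K σ ((x - a) * σ b) : ℝ) : ℂ)) *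
    Complex.exp (-(π : ℂ) * Complex.I * ((trK K σ (a * σ b) : ℝ) : ℂ))

/-- The indefinite theta function attached to a set `T` of orbit representatives. -/
noncomputable def theta (K : IntermediateField ℚ ℝ) (σ : K ≃+* K)
    (T : Set K) (ξ₀ ξ₁ : ℝ) (a b : K) (v : ℂ) : ℂ :=
  ∑' x : T, thetaTerm K σ ξ₀ ξ₁ a b v (x : K)


/-- Poisson summation for a linear polynomial times a Gaussian. -/
theorem poisson1 (v : ℂ) (hv : 0 < v.im) (r : ℝ) (hr : r ≠ 0) (a β : ℝ) (c₁ c₂ : ℂ) :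
    ∃ A : ℂ, HasSum (fun m : ℤ => (c₁ * ((r * m + a : ℝ) : ℂ) + c₂) *
        Complex.exp (π * Complex.I * v * ((r * m + a : ℝ) : ℂ) ^ 2) *
        Complex.exp (-2 * π * Complex.I * ((β * m : ℝ) : ℂ))) A ∧
      HasSum (fun k : ℤ => 1 / (((|r| : ℝ) : ℂ) * (-Complex.I * v) ^ (1 / 2 : ℂ)) *
        ((c₁ * (((k + β) / r : ℝ) : ℂ) / v + c₂) *
        Complex.exp (π * Complex.I * (-1 / v) * (((k + β) / r : ℝ) : ℂ) ^ 2) *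
        Complex.exp (2 * π * Complex.I * ((a * ((k + β) / r) : ℝ) : ℂ)))) A := by
  have hv0 : v ≠ 0 := by rintro rfl; simp at hv
  have hrC : (r : ℂ) ≠ 0 := by exact_mod_cast hr
  have hpi : (π : ℂ) ≠ 0 := by exact_mod_cast Real.pi_ne_zero
  have hI := Complex.I_ne_zero
  set τ : ℂ := v * (r : ℂ) ^ 2 with hτ
  set z : ℂ := v * r * a - β with hz
  have hτ0 : τ ≠ 0 := by positivity
  have hτim : 0 < τ.im := by
    rw [hτ, ← Complex.ofReal_pow, Complex.im_mul_ofReal]; positivity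
  have hτim' : 0 < (-1 / τ).im := by
    rw [neg_div, one_div, Complex.neg_im, Complex.inv_im, neg_div, neg_neg]
    exact div_pos hτim (Complex.normSq_pos.mpr hτ0)
  have hroot : (-Complex.I * τ) ^ (1 / 2 : ℂ) = ((|r| : ℝ) : ℂ) * (-Complex.I * v) ^ (1 / 2 : ℂ) := by
    have h1 : -Complex.I * τ = ((r ^ 2 : ℝ) : ℂ) * (-Complex.I * v) := by
      rw [hτ]; push_cast; ring
    have hx0 : -Complex.I * v ≠ 0 := mul_ne_zero (neg_ne_zero.mpr hI) hv0
    have hr2 : 0 < r ^ 2 := by positivity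
    have hr2C : ((r ^ 2 : ℝ) : ℂ) ≠ 0 := by exact_mod_cast hr2.ne'
    rw [h1, Complex.cpow_def_of_ne_zero (mul_ne_zero hr2C hx0), Complex.cpow_def_of_ne_zero hx0,
      Complex.log_ofReal_mul hr2 hx0, add_mul, Complex.exp_add]
    congr 1
    rw [← sq_abs, Real.log_pow]
    have : ((((2 : ℕ) : ℝ) * Real.log |r| : ℝ) : ℂ) * (1 / 2) = ((Real.log |r| : ℝ) : ℂ) := by
      push_cast; ring
    rw [this, ← Complex.ofReal_exp, Real.exp_log (abs_pos.mpr hr)]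
  set R : ℂ := (-Complex.I * v) ^ (1 / 2 : ℂ) with hR
  have hR0 : R ≠ 0 := by
    rw [hR, Complex.cpow_ne_zero_iff]; left; exact mul_ne_zero (neg_ne_zero.mpr hI) hv0
  have habs : ((|r| : ℝ) : ℂ) ≠ 0 := by exact_mod_cast abs_ne_zero.mpr hr
  have s0 := hasSum_jacobiTheta₂_term z hτim
  have s1 := hasSum_jacobiTheta₂'_term z hτim
  have t0 := hasSum_jacobiTheta₂_term (z / τ) hτim'
  have t1 := hasSum_jacobiTheta₂'_term (z / τ) hτim'
  have S := ((s1.mul_left (c₁ * r / (2 * π * Complex.I))).add (s0.mul_left (c₁ * a + c₂))).mul_left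
    (Complex.exp (π * Complex.I * v * a ^ 2))
  refine ⟨Complex.exp (π * Complex.I * v * a ^ 2) * (c₁ * r / (2 * π * Complex.I) * jacobiTheta₂' z τ +
    (c₁ * a + c₂) * jacobiTheta₂ z τ), ?_, ?_⟩
  · convert! S using 1
    funext m
    rw [jacobiTheta₂'_term, jacobiTheta₂_term]
    have key : Complex.exp (π * Complex.I * v * ((r * m + a : ℝ) : ℂ) ^ 2) *
        Complex.exp (-2 * π * Complex.I * ((β * m : ℝ) : ℂ)) =
        Complex.exp (π * Complex.I * v * a ^ 2) *
        Complex.exp (2 * π * Complex.I * m * z + π * Complex.I * m ^ 2 * τ) := by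
      rw [← Complex.exp_add, ← Complex.exp_add]
      congr 1
      rw [hz, hτ]; push_cast; ring
    rw [mul_assoc (_ + _), key]
    generalize Complex.exp (2 * π * Complex.I * m * z + π * Complex.I * m ^ 2 * τ) = e1
    push_cast; field_simp; ring
  · rw [jacobiTheta₂_functional_equation, jacobiTheta₂'_functional_equation, hroot]
    have T := (((t1.sub (t0.mul_left (2 * π * Complex.I * z))).mul_left
      (1 / (((|r| : ℝ) : ℂ) * R) * Complex.exp (-π * Complex.I * z ^ 2 / τ) / τ)).mul_left
        (c₁ * r / (2 * π * Complex.I))).add ((t0.mul_left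
      (1 / (((|r| : ℝ) : ℂ) * R) * Complex.exp (-π * Complex.I * z ^ 2 / τ))).mul_left (c₁ * a + c₂))
    have T := T.mul_left (Complex.exp (π * Complex.I * v * a ^ 2))
    convert! T using 1
    funext n
    rw [jacobiTheta₂'_term, jacobiTheta₂_term]
    have key : Complex.exp (π * Complex.I * (-1 / v) * (((n + β) / r : ℝ) : ℂ) ^ 2) *
        Complex.exp (2 * π * Complex.I * ((a * ((n + β) / r) : ℝ) : ℂ)) =
        Complex.exp (π * Complex.I * v * a ^ 2) * Complex.exp (-π * Complex.I * z ^ 2 / τ) *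
        Complex.exp (2 * π * Complex.I * n * (z / τ) + π * Complex.I * n ^ 2 * (-1 / τ)) := by
      rw [← Complex.exp_add, ← Complex.exp_add, ← Complex.exp_add]
      congr 1
      rw [hz, hτ]; push_cast; field_simp; ring
    rw [mul_assoc (_ + _), key]
    generalize Complex.exp (2 * π * Complex.I * n * (z / τ) + π * Complex.I * n ^ 2 * (-1 / τ)) = e1
    generalize Complex.exp (-π * Complex.I * z ^ 2 / τ) = e2
    generalize Complex.exp (π * Complex.I * v * a ^ 2) = e3
    rw [hz, hτ]; push_cast; field_simp; ring

theorem summable_gauss1 {c : ℝ} (hc : 0 < c) : Summable fun n : ℤ => Real.exp (-c * (n : ℝ) ^ 2) := by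
  have := summable_pow_mul_jacobiTheta₂_term_bound 0 (T := c / π) (by positivity) 0
  convert! this using 2 with n
  simp; field_simp

/-- Gaussian sums over shifted lattices converge. -/
theorem summable_gauss2 {c : ℝ} (hc : 0 < c) (p₁ p₂ q₁ q₂ a a' : ℝ) (hD : p₁ * q₂ - q₁ * p₂ ≠ 0) :
    Summable fun n : ℤ × ℤ => Real.exp (-c * ((a + n.1 * p₁ + n.2 * p₂) ^ 2 +
      (a' + n.1 * q₁ + n.2 * q₂) ^ 2)) := by
  obtain ⟨M, hM, hM1, hM2⟩ : ∃ M : ℝ, 0 < M ∧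
      (∀ n m : ℝ, n ^ 2 ≤ M * (1 + ((a + n * p₁ + m * p₂) ^ 2 + (a' + n * q₁ + m * q₂) ^ 2))) ∧
      (∀ n m : ℝ, m ^ 2 ≤ M * (1 + ((a + n * p₁ + m * p₂) ^ 2 + (a' + n * q₁ + m * q₂) ^ 2))) := by
    have hD2 : 0 < (p₁ * q₂ - q₁ * p₂) ^ 2 := by positivity
    set D := p₁ * q₂ - q₁ * p₂ with hDdef
    have aux : ∀ x y s t u : ℝ, (x * s + y * t + u) ^ 2 ≤ (s ^ 2 + t ^ 2 + u ^ 2) * (1 + (x ^ 2 + y ^ 2)) := by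
      intro x y s t u
      nlinarith [sq_nonneg (x * t - y * s), sq_nonneg (x * u - s), sq_nonneg (y * u - t)]
    refine ⟨(q₂ ^ 2 + p₂ ^ 2 + (a' * p₂ - a * q₂) ^ 2 + (q₁ ^ 2 + p₁ ^ 2 + (a * q₁ - a' * p₁) ^ 2) + 1) / D ^ 2,
      by positivity, ?_, ?_⟩
    · intro n m
      have h1 := aux (a + n * p₁ + m * p₂) (a' + n * q₁ + m * q₂) q₂ (-p₂) (a' * p₂ - a * q₂)
      have h2 : (a + n * p₁ + m * p₂) * q₂ + (a' + n * q₁ + m * q₂) * (-p₂) + (a' * p₂ - a * q₂) = n * D := by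
        rw [hDdef]; ring
      rw [h2] at h1
      rw [div_mul_eq_mul_div, le_div_iff₀ hD2]
      refine le_trans (le_of_eq (by ring)) (h1.trans ?_)
      refine mul_le_mul_of_nonneg_right ?_ (by positivity)
      nlinarith [sq_nonneg q₁, sq_nonneg p₁, sq_nonneg (a * q₁ - a' * p₁)]
    · intro n m
      have h1 := aux (a + n * p₁ + m * p₂) (a' + n * q₁ + m * q₂) (-q₁) (p₁) (a * q₁ - a' * p₁)
      have h2 : (a + n * p₁ + m * p₂) * (-q₁) + (a' + n * q₁ + m * q₂) * p₁ + (a * q₁ - a' * p₁) = m * D := by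
        rw [hDdef]; ring
      rw [h2] at h1
      rw [div_mul_eq_mul_div, le_div_iff₀ hD2]
      refine le_trans (le_of_eq (by ring)) (h1.trans ?_)
      refine mul_le_mul_of_nonneg_right ?_ (by positivity)
      nlinarith [sq_nonneg q₂, sq_nonneg p₂, sq_nonneg (a' * p₂ - a * q₂)]
  have hc' : 0 < c / (2 * M) := by positivity
  have hs := ((summable_gauss1 hc').mul_of_nonneg (summable_gauss1 hc')
    (fun _ => (Real.exp_pos _).le) (fun _ => (Real.exp_pos _).le)).mul_left (Real.exp c)
  refine Summable.of_nonneg_of_le (fun _ => (Real.exp_pos _).le) ?_ hs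
  rintro ⟨n, m⟩
  simp only
  rw [← Real.exp_add, ← Real.exp_add, Real.exp_le_exp]
  have h1 := hM1 n m
  have h2 := hM2 n m
  set W := (a + n * p₁ + m * p₂) ^ 2 + (a' + n * q₁ + m * q₂) ^ 2
  have h3 : c / (2 * M) * ((n : ℝ) ^ 2 + (m : ℝ) ^ 2) ≤ c / (2 * M) * (2 * M * (1 + W)) := by
    gcongr; linarith
  have h4 : c / (2 * M) * (2 * M * (1 + W)) = c * (1 + W) := by field_simp
  linarith

theorem lin_gauss_bound {c : ℝ} (hc : 0 < c) (x y : ℝ) :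
    (|x| + |y| + 1) * Real.exp (-c * (x ^ 2 + y ^ 2)) ≤
      (2 + 2 / c) * Real.exp (-(c / 2) * (x ^ 2 + y ^ 2)) := by
  have h1 : |x| + |y| + 1 ≤ 2 + (x ^ 2 + y ^ 2) := by
    nlinarith [sq_nonneg (|x| - 1), sq_nonneg (|y| - 1), sq_abs x, sq_abs y, abs_nonneg x, abs_nonneg y]
  have h2 : 2 + (x ^ 2 + y ^ 2) ≤ (2 + 2 / c) * Real.exp (c / 2 * (x ^ 2 + y ^ 2)) := by
    have h3 := Real.add_one_le_exp (c / 2 * (x ^ 2 + y ^ 2))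
    have h4 : 2 / c * (c / 2 * (x ^ 2 + y ^ 2)) = x ^ 2 + y ^ 2 := by field_simp
    have h5 : 0 ≤ c / 2 * (x ^ 2 + y ^ 2) := by positivity
    have h6 : 0 < 2 / c := by positivity
    nlinarith
  have h3 : Real.exp (-(c / 2) * (x ^ 2 + y ^ 2)) =
      Real.exp (c / 2 * (x ^ 2 + y ^ 2)) * Real.exp (-c * (x ^ 2 + y ^ 2)) := by
    rw [← Real.exp_add]; congr 1; ring
  rw [h3, ← mul_assoc]
  gcongr
  exact h1.trans h2

theorem summable_of_lin_gauss {c : ℝ} (hc : 0 < c) (p₁ p₂ q₁ q₂ a a' : ℝ)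
    (hD : p₁ * q₂ - q₁ * p₂ ≠ 0) (C : ℝ) :
    Summable fun n : ℤ × ℤ => C * ((|a + n.1 * p₁ + n.2 * p₂| + |a' + n.1 * q₁ + n.2 * q₂| + 1) *
      Real.exp (-c * ((a + n.1 * p₁ + n.2 * p₂) ^ 2 + (a' + n.1 * q₁ + n.2 * q₂) ^ 2))) := by
  refine Summable.mul_left _ ?_
  refine Summable.of_nonneg_of_le (fun _ => by positivity) (fun n => lin_gauss_bound hc _ _) ?_
  exact (summable_gauss2 (half_pos hc) p₁ p₂ q₁ q₂ a a' hD).mul_left _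

/-- Linear form times a Gaussian on `ℝ²`. -/
noncomputable def gK (c₁ c₂ : ℝ) (w : ℂ) (x y : ℝ) : ℂ :=
  ((c₁ * x + c₂ * y : ℝ) : ℂ) * Complex.exp (π * Complex.I * w * ((x ^ 2 + y ^ 2 : ℝ) : ℂ))

theorem norm_gauss (w : ℂ) (u : ℝ) :
    ‖Complex.exp (π * Complex.I * w * (u : ℂ))‖ = Real.exp (-(π * w.im) * u) := by
  rw [Complex.norm_exp]
  congr 1
  simp [Complex.mul_re, Complex.mul_im]

theorem norm_phase (s : ℂ) (u : ℝ) (hs : ∃ t : ℝ, s = t * Complex.I) :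
    ‖Complex.exp (s * (u : ℂ))‖ = 1 := by
  obtain ⟨t, rfl⟩ := hs
  rw [Complex.norm_exp]
  simp

theorem norm_gK_le (c₁ c₂ : ℝ) (w : ℂ) (x y : ℝ) :
    ‖gK c₁ c₂ w x y‖ ≤ (|c₁| + |c₂|) * ((|x| + |y| + 1) * Real.exp (-(π * w.im) * (x ^ 2 + y ^ 2))) := by
  rw [gK, norm_mul, norm_gauss, Complex.norm_real, Real.norm_eq_abs, ← mul_assoc]
  gcongr
  refine (abs_add_le _ _).trans ?_
  rw [abs_mul, abs_mul]
  nlinarith [abs_nonneg x, abs_nonneg y, abs_nonneg c₁, abs_nonneg c₂,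
    mul_nonneg (abs_nonneg c₁) (abs_nonneg y), mul_nonneg (abs_nonneg c₂) (abs_nonneg x)]

theorem summable_gK (c₁ c₂ : ℝ) (w : ℂ) (hw : 0 < w.im) (p₁ p₂ q₁ q₂ a a' : ℝ)
    (hD : p₁ * q₂ - q₁ * p₂ ≠ 0) (s : ℂ) (hs : ∃ t : ℝ, s = t * Complex.I) (φ : ℤ × ℤ → ℝ) :
    Summable fun n : ℤ × ℤ => gK c₁ c₂ w (a + n.1 * p₁ + n.2 * p₂) (a' + n.1 * q₁ + n.2 * q₂) *
      Complex.exp (s * ((φ n : ℝ) : ℂ)) := by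
  have hc : 0 < π * w.im := by positivity
  refine Summable.of_norm_bounded (summable_of_lin_gauss hc p₁ p₂ q₁ q₂ a a' hD (|c₁| + |c₂|)) ?_
  intro n
  rw [norm_mul, norm_phase _ _ hs, mul_one]
  exact norm_gK_le _ _ _ _ _

theorem im_neg_inv {v : ℂ} (hv : 0 < v.im) : 0 < (-1 / v).im := by
  have hv0 : v ≠ 0 := by rintro rfl; simp at hv
  rw [neg_div, one_div, Complex.neg_im, Complex.inv_im, neg_div, neg_neg]
  exact div_pos hv (Complex.normSq_pos.mpr hv0)

theorem poisson_tri (v : ℂ) (hv : 0 < v.im) (r p q a a' β₁ β₂ c₁ c₂ : ℝ) (hr : r ≠ 0) (hq : q ≠ 0) :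
    ∑' n : ℤ × ℤ, gK c₁ c₂ v (a + n.1 * p + n.2 * r) (a' + n.1 * q + n.2 * 0) *
        Complex.exp (-2 * π * Complex.I * ((β₁ * n.1 + β₂ * n.2 : ℝ) : ℂ)) =
      1 / (((|r * q| : ℝ) : ℂ) * (-Complex.I * v) * v) *
      ∑' n : ℤ × ℤ, gK c₁ c₂ (-1 / v) ((n.2 + β₂) / r) ((n.1 + (β₁ - p * ((n.2 + β₂) / r))) / q) *
        Complex.exp (2 * π * Complex.I * ((a * ((n.2 + β₂) / r) +
          a' * ((n.1 + (β₁ - p * ((n.2 + β₂) / r))) / q) : ℝ) : ℂ)) := by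
  have hv0 : v ≠ 0 := by rintro rfl; simp at hv
  have hv' := im_neg_inv hv
  set R : ℂ := (-Complex.I * v) ^ (1 / 2 : ℂ) with hR
  have hRR : R * R = -Complex.I * v := by
    rw [hR, ← Complex.cpow_add _ _ (mul_ne_zero (neg_ne_zero.mpr Complex.I_ne_zero) hv0)]
    norm_num
  have hR0 : R ≠ 0 := by
    rintro h; rw [h] at hRR; simp [hv0] at hRR
  have h2I : ∃ t : ℝ, (2 * π * Complex.I : ℂ) = t * Complex.I := ⟨2 * π, by push_cast; ring⟩
  have h2I' : ∃ t : ℝ, (-2 * π * Complex.I : ℂ) = t * Complex.I := ⟨-2 * π, by push_cast; ring⟩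
  have hsL := summable_gK c₁ c₂ v hv p r q 0 a a' (by simp [hr, hq]) _ h2I'
    (fun n => β₁ * n.1 + β₂ * n.2)
  have hsR : Summable fun n : ℤ × ℤ => gK c₁ c₂ (-1 / v) ((n.2 + β₂) / r)
      ((n.1 + (β₁ - p * ((n.2 + β₂) / r))) / q) *
        Complex.exp (2 * π * Complex.I * ((a * ((n.2 + β₂) / r) +
          a' * ((n.1 + (β₁ - p * ((n.2 + β₂) / r))) / q) : ℝ) : ℂ)) := by
    have := summable_gK c₁ c₂ (-1 / v) hv' 0 (1 / r) (1 / q) (-p / (r * q)) (β₂ / r)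
      ((β₁ - p * (β₂ / r)) / q) (by simp [hr, hq]) _ h2I
      (fun n => a * ((n.2 + β₂) / r) + a' * ((n.1 + (β₁ - p * ((n.2 + β₂) / r))) / q))
    refine this.congr fun n => ?_
    congr 2
    · ring
    · field_simp; ring
  -- the mixed summand
  let mix : ℤ → ℤ → ℂ := fun n k => 1 / (((|r| : ℝ) : ℂ) * R) *
        ((c₁ * (((k + β₂) / r : ℝ) : ℂ) / v + c₂ * ((a' + n * q : ℝ) : ℂ)) *
        Complex.exp (π * Complex.I * (-1 / v) * ((((k + β₂) / r : ℝ) ^ 2 : ℝ) : ℂ)) *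
        Complex.exp (2 * π * Complex.I * (((a + n * p) * ((k + β₂) / r) : ℝ) : ℂ))) *
        (Complex.exp (π * Complex.I * v * (((a' + n * q) ^ 2 : ℝ) : ℂ)) *
          Complex.exp (-2 * π * Complex.I * ((β₁ * n : ℝ) : ℂ)))
  have hmix : Summable (Function.uncurry mix) := by
    set c := min (π * v.im) (π * (-1 / v).im) with hcdef
    have hc : 0 < c := lt_min (by positivity) (by positivity)
    set B : ℝ := ‖(1 / (((|r| : ℝ) : ℂ) * R))‖ * (|c₁| / ‖v‖ + |c₂|) with hB
    have := summable_of_lin_gauss hc 0 (1 / r) q 0 (β₂ / r) a' (by simp [hr, hq]) B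
    refine Summable.of_norm_bounded this ?_
    rintro ⟨n, k⟩
    simp only [Function.uncurry, mix, norm_mul, norm_gauss, norm_phase _ _ h2I, norm_phase _ _ h2I',
      mul_one, mul_zero, add_zero]
    have hy : β₂ / r + k * (1 / r) = (k + β₂) / r := by ring
    rw [hy]
    set y := (k + β₂) / r with hydef
    set x := a' + n * q with hx
    rw [hB, mul_assoc, mul_assoc, mul_assoc]
    rw [← Real.exp_add]
    refine mul_le_mul_of_nonneg_left ?_ (norm_nonneg _)
    rw [← mul_assoc (|c₁| / ‖v‖ + |c₂|)]
    refine mul_le_mul ?_ (Real.exp_le_exp.mpr ?_) (Real.exp_pos _).le (by positivity)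
    · refine (norm_add_le _ _).trans ?_
      rw [norm_div, norm_mul, norm_mul, Complex.norm_real, Complex.norm_real, Complex.norm_real,
        Complex.norm_real, Real.norm_eq_abs, Real.norm_eq_abs, Real.norm_eq_abs, Real.norm_eq_abs]
      have h1 : |c₁| * |y| / ‖v‖ = |c₁| / ‖v‖ * |y| := by ring
      rw [h1]
      have h2 : 0 ≤ |c₁| / ‖v‖ := by positivity
      nlinarith [abs_nonneg x, abs_nonneg y, abs_nonneg c₂,
        mul_nonneg h2 (abs_nonneg x), mul_nonneg (abs_nonneg c₂) (abs_nonneg y)]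
    · have h1 : c ≤ π * v.im := min_le_left _ _
      have h2 : c ≤ π * (-1 / v).im := min_le_right _ _
      nlinarith [mul_le_mul_of_nonneg_right h1 (sq_nonneg x), mul_le_mul_of_nonneg_right h2 (sq_nonneg y)]
  rw [hsL.tsum_prod]
  have step1 : ∀ n : ℤ, ∑' m : ℤ, gK c₁ c₂ v (a + n * p + m * r) (a' + n * q + m * 0) *
        Complex.exp (-2 * π * Complex.I * ((β₁ * n + β₂ * m : ℝ) : ℂ)) = ∑' k, mix n k := by
    intro n
    obtain ⟨A, h1, h2⟩ := poisson1 v hv r hr (a + n * p) β₂ c₁ (c₂ * ((a' + n * q : ℝ) : ℂ))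
    set M := (Complex.exp (π * Complex.I * v * (((a' + n * q) ^ 2 : ℝ) : ℂ)) *
          Complex.exp (-2 * π * Complex.I * ((β₁ * n : ℝ) : ℂ))) with hM
    have e1 := (h1.mul_right M).tsum_eq
    have e2 := (h2.mul_right M).tsum_eq
    rw [← e1] at e2
    have e3 : ∀ k : ℤ, mix n k = 1 / (((|r| : ℝ) : ℂ) * R) *
        ((c₁ * (((k + β₂) / r : ℝ) : ℂ) / v + c₂ * ((a' + n * q : ℝ) : ℂ)) *
        Complex.exp (π * Complex.I * (-1 / v) * (((k + β₂) / r : ℝ) : ℂ) ^ 2) *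
        Complex.exp (2 * π * Complex.I * (((a + n * p) * ((k + β₂) / r) : ℝ) : ℂ))) * M := by
      intro k
      simp only [mix, hM, Complex.ofReal_pow]
    rw [tsum_congr e3, e2]
    refine tsum_congr fun m => ?_
    rw [gK, hM]
    have key : Complex.exp (π * Complex.I * v * (((a + n * p + m * r) ^ 2 + (a' + n * q + m * 0) ^ 2 : ℝ) : ℂ)) *
        Complex.exp (-2 * π * Complex.I * ((β₁ * n + β₂ * m : ℝ) : ℂ)) =
        Complex.exp (π * Complex.I * v * ((r * m + (a + n * p) : ℝ) : ℂ) ^ 2) *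
        Complex.exp (-2 * π * Complex.I * ((β₂ * m : ℝ) : ℂ)) *
        (Complex.exp (π * Complex.I * v * (((a' + n * q) ^ 2 : ℝ) : ℂ)) *
          Complex.exp (-2 * π * Complex.I * ((β₁ * n : ℝ) : ℂ))) := by
      simp only [← Complex.exp_add]
      congr 1; push_cast; ring
    rw [mul_assoc, key]
    push_cast; ring
  rw [tsum_congr step1, hmix.tsum_comm.symm]
  have step2 : ∀ k : ℤ, ∑' n, mix n k = 1 / (((|r * q| : ℝ) : ℂ) * (-Complex.I * v) * v) *
      ∑' j : ℤ, gK c₁ c₂ (-1 / v) ((k + β₂) / r) ((j + (β₁ - p * ((k + β₂) / r))) / q) *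
        Complex.exp (2 * π * Complex.I * ((a * ((k + β₂) / r) +
          a' * ((j + (β₁ - p * ((k + β₂) / r))) / q) : ℝ) : ℂ)) := by
    intro k
    set y : ℝ := (k + β₂) / r with hy
    obtain ⟨A, h1, h2⟩ := poisson1 v hv q hq a' (β₁ - p * y) c₂ (c₁ * (y : ℂ) / v)
    set M := 1 / (((|r| : ℝ) : ℂ) * R) * (Complex.exp (π * Complex.I * (-1 / v) * ((y ^ 2 : ℝ) : ℂ)) *
      Complex.exp (2 * π * Complex.I * ((a * y : ℝ) : ℂ))) with hM
    have e1 := (h1.mul_right M).tsum_eq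
    have e2 := (h2.mul_right M).tsum_eq
    rw [← e1] at e2
    rw [← tsum_mul_left]
    have e3 : ∀ n : ℤ, mix n k = (c₂ * ((q * n + a' : ℝ) : ℂ) + c₁ * (y : ℂ) / v) *
        Complex.exp (π * Complex.I * v * ((q * n + a' : ℝ) : ℂ) ^ 2) *
        Complex.exp (-2 * π * Complex.I * (((β₁ - p * y) * n : ℝ) : ℂ)) * M := by
      intro n
      simp only [mix, hM, ← hy]
      have key : Complex.exp (2 * π * Complex.I * (((a + n * p) * y : ℝ) : ℂ)) *
         (Complex.exp (π * Complex.I * v * (((a' + n * q) ^ 2 : ℝ) : ℂ)) *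
          Complex.exp (-2 * π * Complex.I * ((β₁ * n : ℝ) : ℂ))) =
          Complex.exp (π * Complex.I * v * ((q * n + a' : ℝ) : ℂ) ^ 2) *
        Complex.exp (-2 * π * Complex.I * (((β₁ - p * y) * n : ℝ) : ℂ)) *
        Complex.exp (2 * π * Complex.I * ((a * y : ℝ) : ℂ)) := by
        simp only [← Complex.exp_add]
        congr 1; push_cast; ring
      rw [mul_assoc, mul_assoc _ (Complex.exp (2 * π * Complex.I * (((a + n * p) * y : ℝ) : ℂ))), key]
      push_cast; ring
    rw [tsum_congr e3, ← e2]
    refine tsum_congr fun j => ?_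
    set y' : ℝ := (j + (β₁ - p * y)) / q with hy'
    rw [gK, hM, abs_mul]
    have key : Complex.exp (π * Complex.I * (-1 / v) * ((y ^ 2 + y' ^ 2 : ℝ) : ℂ)) *
        Complex.exp (2 * π * Complex.I * ((a * y + a' * y' : ℝ) : ℂ)) =
        Complex.exp (π * Complex.I * (-1 / v) * (y' : ℂ) ^ 2) *
        Complex.exp (2 * π * Complex.I * ((a' * y' : ℝ) : ℂ)) *
        (Complex.exp (π * Complex.I * (-1 / v) * ((y ^ 2 : ℝ) : ℂ)) *
      Complex.exp (2 * π * Complex.I * ((a * y : ℝ) : ℂ))) := by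
      simp only [← Complex.exp_add]
      congr 1; push_cast; ring
    rw [mul_assoc ((c₁ * y + c₂ * y' : ℝ) : ℂ), key, ← hR, ← hRR]
    have : ((|r| : ℝ) : ℂ) ≠ 0 := by exact_mod_cast abs_ne_zero.mpr hr
    have : ((|q| : ℝ) : ℂ) ≠ 0 := by exact_mod_cast abs_ne_zero.mpr hq
    generalize Complex.exp (π * Complex.I * (-1 / v) * (y' : ℂ) ^ 2) = E1
    generalize Complex.exp (2 * π * Complex.I * ((a' * y' : ℝ) : ℂ)) = E2
    push_cast; field_simp; ring
  rw [tsum_congr step2, tsum_mul_left]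
  congr 1
  rw [← (Equiv.prodComm ℤ ℤ).tsum_eq]
  have hsR' := (Equiv.prodComm ℤ ℤ).summable_iff.mpr hsR
  exact hsR'.tsum_prod.symm

theorem poisson2 (v : ℂ) (hv : 0 < v.im) (p₁ p₂ q₁ q₂ a a' β₁ β₂ c₁ c₂ : ℝ)
    (hD : p₁ * q₂ - q₁ * p₂ ≠ 0) (Y Y' : ℤ × ℤ → ℝ)
    (hY₁ : ∀ n, p₁ * Y n + q₁ * Y' n = n.1 + β₁) (hY₂ : ∀ n, p₂ * Y n + q₂ * Y' n = n.2 + β₂) :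
    ∑' n : ℤ × ℤ, gK c₁ c₂ v (a + n.1 * p₁ + n.2 * p₂) (a' + n.1 * q₁ + n.2 * q₂) *
        Complex.exp (-2 * π * Complex.I * ((β₁ * n.1 + β₂ * n.2 : ℝ) : ℂ)) =
      1 / (((|p₁ * q₂ - q₁ * p₂| : ℝ) : ℂ) * (-Complex.I * v) * v) *
      ∑' n : ℤ × ℤ, gK c₁ c₂ (-1 / v) (Y n) (Y' n) *
        Complex.exp (2 * π * Complex.I * ((a * Y n + a' * Y' n : ℝ) : ℂ)) := by
  have hpos : 0 < p₂ ^ 2 + q₂ ^ 2 := by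
    rcases eq_or_ne p₂ 0 with h | h
    · have : q₂ ≠ 0 := by rintro rfl; simp [h] at hD
      positivity
    · positivity
  set ρ := Real.sqrt (p₂ ^ 2 + q₂ ^ 2) with hρ
  have hρ0 : ρ ≠ 0 := (Real.sqrt_pos.mpr hpos).ne'
  have hρ2 : ρ ^ 2 = p₂ ^ 2 + q₂ ^ 2 := Real.sq_sqrt hpos.le
  obtain ⟨C, hC⟩ : ∃ C, C = p₂ / ρ := ⟨_, rfl⟩
  obtain ⟨S, hS⟩ : ∃ S, S = q₂ / ρ := ⟨_, rfl⟩
  have hCS : C ^ 2 + S ^ 2 = 1 := by rw [hC, hS]; field_simp; linarith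
  have hp₂ : p₂ = ρ * C := by rw [hC]; field_simp
  have hq₂ : q₂ = ρ * S := by rw [hS]; field_simp
  have hrq : ρ * (-S * p₁ + C * q₁) = -(p₁ * q₂ - q₁ * p₂) := by rw [hp₂, hq₂]; ring
  have hq0 : -S * p₁ + C * q₁ ≠ 0 := by
    intro h; rw [h, mul_zero] at hrq; exact hD (by linarith)
  have rot : ∀ (w : ℂ) (x x' : ℝ), gK c₁ c₂ w x x' =
      gK (c₁ * C + c₂ * S) (-c₁ * S + c₂ * C) w (C * x + S * x') (-S * x + C * x') := by
    intro w x x'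
    unfold gK
    have h1 : (C * x + S * x') ^ 2 + (-S * x + C * x') ^ 2 = x ^ 2 + x' ^ 2 := by
      linear_combination (x ^ 2 + x' ^ 2) * hCS
    have h2 : (c₁ * C + c₂ * S) * (C * x + S * x') + (-c₁ * S + c₂ * C) * (-S * x + C * x') =
      c₁ * x + c₂ * x' := by
      linear_combination (c₁ * x + c₂ * x') * hCS
    rw [h1, h2]
  have main := poisson_tri v hv ρ (C * p₁ + S * q₁) (-S * p₁ + C * q₁) (C * a + S * a')
    (-S * a + C * a') β₁ β₂ (c₁ * C + c₂ * S) (-c₁ * S + c₂ * C) hρ0 hq0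
  rw [hrq, abs_neg] at main
  convert! main using 1
  · refine tsum_congr fun n => ?_
    rw [rot]
    congr 2
    · linear_combination (n.2 : ℝ) * (C * hp₂ + S * hq₂ + ρ * hCS)
    · linear_combination (n.2 : ℝ) * (-S * hp₂ + C * hq₂)
  · congr 1
    refine tsum_congr fun n => ?_
    have h1 : (n.2 + β₂) / ρ = C * Y n + S * Y' n := by
      rw [← hY₂, hp₂, hq₂]; field_simp
    have h2 : (n.1 + (β₁ - (C * p₁ + S * q₁) * (C * Y n + S * Y' n))) / (-S * p₁ + C * q₁) =
        -S * Y n + C * Y' n := by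
      rw [div_eq_iff hq0]
      linear_combination (-1 : ℝ) * hY₁ n - (p₁ * Y n + q₁ * Y' n) * hCS
    rw [h1, h2, rot]
    congr 4
    linear_combination -(a * Y n + a' * Y' n) * hCS

open MeasureTheory in
theorem kern (w : ℂ) (hw : 0 < w.im) (c : ℝ) (hc : 0 < c) :
    Integrable (fun u : ℝ => ((c * Real.exp u : ℝ) : ℂ) * Complex.exp (π * Complex.I * w *
      (((c * Real.exp u) ^ 2 + (c * Real.exp (-u)) ^ 2 : ℝ) : ℂ))) ∧
    ∫ u : ℝ, ((c * Real.exp u : ℝ) : ℂ) * Complex.exp (π * Complex.I * w *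
      (((c * Real.exp u) ^ 2 + (c * Real.exp (-u)) ^ 2 : ℝ) : ℂ)) =
      1 / (2 * (-Complex.I * w) ^ (1 / 2 : ℂ)) * Complex.exp (2 * π * Complex.I * w * ((c ^ 2 : ℝ) : ℂ)) := by
  have hw0 : w ≠ 0 := by rintro rfl; simp at hw
  have hpi : (π : ℂ) ≠ 0 := by exact_mod_cast Real.pi_ne_zero
  set b : ℂ := -(π * Complex.I * w) with hb
  have hbre : 0 < b.re := by
    rw [hb]; simp [Complex.mul_re, Complex.mul_im]; positivity
  set E : ℝ → ℂ := fun y => Complex.exp (-b * (y : ℂ) ^ 2) with hE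
  have hEint : Integrable E := integrable_cexp_neg_mul_sq hbre
  have hEval : ∫ y, E y = 1 / (-Complex.I * w) ^ (1 / 2 : ℂ) := by
    rw [hE, integral_gaussian_complex hbre]
    have h1 : (π : ℂ) / b = (-Complex.I * w)⁻¹ := by
      rw [hb]; field_simp
    have h2 : (-Complex.I * w).arg ≠ π := ?_
    · rw [h1, Complex.inv_cpow _ _ h2, ← one_div]
    intro h
    rw [Complex.arg_eq_pi_iff] at h
    have := h.1
    simp at this
    linarith
  have hder : ∀ u ∈ (Set.univ : Set ℝ), HasDerivWithinAt (fun u => 2 * c * Real.sinh u)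
      (2 * c * Real.cosh u) Set.univ u := fun u _ =>
    ((Real.hasDerivAt_sinh u).const_mul (2 * c)).hasDerivWithinAt
  have hinj : Set.InjOn (fun u => 2 * c * Real.sinh u) Set.univ := by
    intro x _ y _ h
    have : (2 * c) ≠ 0 := by positivity
    exact Real.sinh_injective (mul_left_cancel₀ this h)
  have himg : (fun u => 2 * c * Real.sinh u) '' Set.univ = Set.univ := by
    rw [Set.image_univ, Set.range_eq_univ]
    intro y
    obtain ⟨u, hu⟩ := Real.sinh_surjective (y / (2 * c))
    exact ⟨u, by simp only [hu]; field_simp⟩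
  have hFint := (integrableOn_image_iff_integrableOn_abs_deriv_smul MeasurableSet.univ hder hinj E)
  have hFval := (integral_image_eq_integral_abs_deriv_smul MeasurableSet.univ hder hinj E)
  rw [himg, integrableOn_univ, integrableOn_univ] at hFint
  rw [himg, Measure.restrict_univ, hEval] at hFval
  have hFint := hFint.mp hEint
  set F : ℝ → ℂ := fun u => |2 * c * Real.cosh u| • E (2 * c * Real.sinh u) with hF
  set Q : ℂ := Complex.exp (2 * π * Complex.I * w * ((c ^ 2 : ℝ) : ℂ)) with hQ
  have hch : ∀ u, |2 * c * Real.cosh u| = c * Real.exp u + c * Real.exp (-u) := by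
    intro u
    rw [abs_of_pos (by have := Real.cosh_pos u; positivity), Real.cosh_eq]; ring
  have hexp : ∀ u : ℝ, Complex.exp (π * Complex.I * w *
      (((c * Real.exp u) ^ 2 + (c * Real.exp (-u)) ^ 2 : ℝ) : ℂ)) = Q * E (2 * c * Real.sinh u) := by
    intro u
    rw [hQ, hE, ← Complex.exp_add]
    congr 1
    have h1 : (c * Real.exp u) ^ 2 + (c * Real.exp (-u)) ^ 2 = 2 * c ^ 2 + (2 * c * Real.sinh u) ^ 2 := by
      have h2 : Real.exp u * Real.exp (-u) = 1 := by rw [← Real.exp_add]; simp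
      rw [Real.sinh_eq]; linear_combination (2 * c ^ 2) * h2
    rw [h1, hb]; push_cast; ring
  set G : ℝ → ℂ := fun u : ℝ => ((c * Real.exp u : ℝ) : ℂ) * Complex.exp (π * Complex.I * w *
      (((c * Real.exp u) ^ 2 + (c * Real.exp (-u)) ^ 2 : ℝ) : ℂ)) with hG
  have hGint : Integrable G := by
    refine Integrable.mono (hFint.const_mul Q) ?_ ?_
    · apply Continuous.aestronglyMeasurable
      rw [hG]; fun_prop
    · refine Filter.Eventually.of_forall fun u => ?_
      simp only [hG, hF]
      rw [hexp, hch, norm_mul, norm_mul, norm_mul, norm_smul, Complex.norm_real, Real.norm_eq_abs,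
        Real.norm_eq_abs, abs_of_pos (by positivity), abs_of_pos (by positivity)]
      have h0 : 0 ≤ ‖Q‖ * ‖E (2 * c * Real.sinh u)‖ := by positivity
      have h1 : 0 ≤ c * Real.exp (-u) := by positivity
      nlinarith [mul_nonneg h0 h1]
  refine ⟨hGint, ?_⟩
  have hsum : ∀ u, G u + G (-u) = Q * F u := by
    intro u
    have hx := hexp (-u)
    rw [neg_neg] at hx
    simp only [hG, hF, neg_neg]
    rw [hexp, hx, hch, Real.sinh_neg, Complex.real_smul]
    have : E (2 * c * -Real.sinh u) = E (2 * c * Real.sinh u) := by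
      simp only [hE]; congr 1; push_cast; ring
    rw [this]; push_cast; ring
  have h1 : ∫ u, (G u + G (-u)) = (∫ u, G u) + ∫ u, G u := by
    rw [integral_add hGint hGint.comp_neg, integral_neg_eq_self]
  have h2 : ∫ u, (G u + G (-u)) = Q * (1 / (-Complex.I * w) ^ (1 / 2 : ℂ)) := by
    rw [hFval]
    simp_rw [hsum]
    rw [integral_const_mul]
  have h3 : (∫ u, G u) = (1 / 2) * (Q * (1 / (-Complex.I * w) ^ (1 / 2 : ℂ))) := by
    rw [← h2, h1]; ring
  rw [h3]
  field_simp

open MeasureTheory in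
theorem kern2 (w : ℂ) (hw : 0 < w.im) (T : ℝ) (hT : 0 < T) (x x' : ℝ) (hx : x ≠ 0) (hx' : x' ≠ 0) :
    Integrable (fun s : ℝ => ((Real.exp (T * s) * x : ℝ) : ℂ) * Complex.exp (π * Complex.I * w *
      (((Real.exp (T * s) * x) ^ 2 + (Real.exp (-(T * s)) * x') ^ 2 : ℝ) : ℂ))) ∧
    ∫ s : ℝ, ((Real.exp (T * s) * x : ℝ) : ℂ) * Complex.exp (π * Complex.I * w *
      (((Real.exp (T * s) * x) ^ 2 + (Real.exp (-(T * s)) * x') ^ 2 : ℝ) : ℂ)) =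
      1 / (2 * T * (-Complex.I * w) ^ (1 / 2 : ℂ)) * ((Real.sign x : ℝ) : ℂ) *
        Complex.exp (2 * π * Complex.I * w * ((|x * x'| : ℝ) : ℂ)) := by
  set c := Real.sqrt |x * x'| with hcdef
  have hc : 0 < c := Real.sqrt_pos.mpr (abs_pos.mpr (mul_ne_zero hx hx'))
  have hc2 : c ^ 2 = |x * x'| := Real.sq_sqrt (abs_nonneg _)
  have hax : 0 < |x| := abs_pos.mpr hx
  set d := Real.log (|x| / c) with hd
  have hed : c * Real.exp d = |x| := by
    rw [hd, Real.exp_log (by positivity)]; field_simp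
  have hed' : c * Real.exp (-d) = |x'| := by
    rw [hd, Real.exp_neg, Real.exp_log (by positivity), inv_div]
    rw [abs_mul] at hc2
    field_simp; linarith
  obtain ⟨h1, h2⟩ := kern w hw c hc
  set G : ℝ → ℂ := fun u : ℝ => ((c * Real.exp u : ℝ) : ℂ) * Complex.exp (π * Complex.I * w *
      (((c * Real.exp u) ^ 2 + (c * Real.exp (-u)) ^ 2 : ℝ) : ℂ)) with hG
  have hsgn : Real.sign x * |x| = x := by
    rcases hx.lt_or_gt with h | h
    · rw [Real.sign_of_neg h, abs_of_neg h]; ring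
    · rw [Real.sign_of_pos h, abs_of_pos h]; ring
  have key : (fun s : ℝ => ((Real.exp (T * s) * x : ℝ) : ℂ) * Complex.exp (π * Complex.I * w *
      (((Real.exp (T * s) * x) ^ 2 + (Real.exp (-(T * s)) * x') ^ 2 : ℝ) : ℂ))) =
      fun s => ((Real.sign x : ℝ) : ℂ) * G (T * s + d) := by
    funext s
    simp only [hG]
    have e1 : c * Real.exp (T * s + d) = Real.exp (T * s) * |x| := by
      rw [Real.exp_add, ← hed]; ring
    have e2 : c * Real.exp (-(T * s + d)) = Real.exp (-(T * s)) * |x'| := by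
      rw [neg_add, Real.exp_add, ← hed']; ring
    rw [e1, e2, mul_pow, mul_pow, mul_pow, mul_pow, sq_abs, sq_abs, ← mul_assoc, ← Complex.ofReal_mul]
    congr 2
    linear_combination (-Real.exp (T * s)) * hsgn
  have hi : Integrable (fun s => G (T * s + d)) :=
    (h1.comp_add_right d).comp_mul_left' (g := fun u => G (u + d)) hT.ne'
  have hv : ∫ s, G (T * s + d) = ((|T⁻¹| : ℝ) : ℂ) * ∫ u, G u := by
    have := Measure.integral_comp_mul_left (fun u => G (u + d)) T
    rw [integral_add_right_eq_self] at this
    rw [← Complex.real_smul]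
    exact this
  rw [key]
  refine ⟨hi.const_mul _, ?_⟩
  rw [integral_const_mul, hv, h2, hc2, abs_of_pos (by positivity)]
  push_cast
  have : (T : ℂ) ≠ 0 := by exact_mod_cast hT.ne'
  field_simp

open MeasureTheory in
theorem kern3 (w : ℂ) (hw : 0 < w.im) (T : ℝ) (hT : 0 < T) (c₁ c₂ x x' : ℝ) (hx : x ≠ 0) (hx' : x' ≠ 0) :
    Integrable (fun s : ℝ => gK c₁ c₂ w (Real.exp (T * s) * x) (Real.exp (-(T * s)) * x')) ∧
    ∫ s : ℝ, gK c₁ c₂ w (Real.exp (T * s) * x) (Real.exp (-(T * s)) * x') =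
      1 / (2 * T * (-Complex.I * w) ^ (1 / 2 : ℂ)) *
        (((c₂ * Real.sign x' + c₁ * Real.sign x : ℝ) : ℂ) *
        Complex.exp (2 * π * Complex.I * w * ((|x * x'| : ℝ) : ℂ))) := by
  obtain ⟨i1, v1⟩ := kern2 w hw T hT x x' hx hx'
  obtain ⟨i2, v2⟩ := kern2 w hw T hT x' x hx' hx
  have i2 := i2.comp_neg
  rw [← integral_neg_eq_self] at v2
  have key : (fun s : ℝ => gK c₁ c₂ w (Real.exp (T * s) * x) (Real.exp (-(T * s)) * x')) =
     fun s => (c₁ : ℂ) * (((Real.exp (T * s) * x : ℝ) : ℂ) * Complex.exp (π * Complex.I * w *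
      (((Real.exp (T * s) * x) ^ 2 + (Real.exp (-(T * s)) * x') ^ 2 : ℝ) : ℂ))) +
      c₂ * (((Real.exp (T * -s) * x' : ℝ) : ℂ) * Complex.exp (π * Complex.I * w *
      (((Real.exp (T * -s) * x') ^ 2 + (Real.exp (-(T * -s)) * x) ^ 2 : ℝ) : ℂ))) := by
    funext s
    unfold gK
    rw [mul_neg, neg_neg, add_comm ((Real.exp (-(T * s)) * x') ^ 2)]
    push_cast; ring
  rw [key]
  refine ⟨(i1.const_mul _).add (i2.const_mul _), ?_⟩
  rw [integral_add (i1.const_mul _) (i2.const_mul _), integral_const_mul, integral_const_mul, v1, v2,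
    mul_comm x' x]
  push_cast; ring

theorem gK_zero (c₁ c₂ : ℝ) (w : ℂ) : gK c₁ c₂ w 0 0 = 0 := by simp [gK]

theorem coeK_zpow (K : IntermediateField ℚ ℝ) (x : K) (n : ℤ) : ((x ^ n : K) : ℝ) = (x : ℝ) ^ n :=
  map_zpow₀ K.val x n

/-- The character part of the theta term. -/
noncomputable def chiK (K : IntermediateField ℚ ℝ) (σ : K ≃+* K) (a b x : K) : ℂ :=
  Complex.exp (-2 * (π : ℂ) * Complex.I * ((trK K σ ((x - a) * σ b) : ℝ) : ℂ)) *
    Complex.exp (-(π : ℂ) * Complex.I * ((trK K σ (a * σ b) : ℝ) : ℂ))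

theorem norm_chiK (K : IntermediateField ℚ ℝ) (σ : K ≃+* K) (a b x : K) : ‖chiK K σ a b x‖ = 1 := by
  rw [chiK, norm_mul, norm_phase _ _ ⟨-2 * π, by push_cast; ring⟩,
    norm_phase _ _ ⟨-π, by push_cast; ring⟩, one_mul]

theorem gK_scaled_bound (c₁ c₂ : ℝ) (w : ℂ) (hw : 0 < w.im) (T : ℝ) (hT : 0 < T) (x x' s : ℝ)
    (hs0 : 0 ≤ s) (hs1 : s ≤ 1) :
    ‖gK c₁ c₂ w (Real.exp (T * s) * x) (Real.exp (-(T * s)) * x')‖ ≤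
      ((|c₁| + |c₂|) * Real.exp T) * ((|x| + |x'| + 1) *
        Real.exp (-(π * w.im * Real.exp (-(2 * T))) * (x ^ 2 + x' ^ 2))) := by
  refine (norm_gK_le _ _ _ _ _).trans ?_
  rw [mul_assoc]
  refine mul_le_mul_of_nonneg_left ?_ (by positivity)
  rw [← mul_assoc]
  have hTs : 0 ≤ T * s := by positivity
  have hTs' : T * s ≤ T := by nlinarith
  have e1 : Real.exp (T * s) ≤ Real.exp T := Real.exp_le_exp.mpr hTs'
  have e2 : Real.exp (-(T * s)) ≤ Real.exp T := Real.exp_le_exp.mpr (by linarith)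
  have e3 : 1 ≤ Real.exp T := Real.one_le_exp hT.le
  refine mul_le_mul ?_ (Real.exp_le_exp.mpr ?_) (Real.exp_pos _).le (by positivity)
  · rw [abs_mul, abs_mul, abs_of_pos (Real.exp_pos _), abs_of_pos (Real.exp_pos _)]
    nlinarith [mul_le_mul_of_nonneg_right e1 (abs_nonneg x), mul_le_mul_of_nonneg_right e2 (abs_nonneg x')]
  · have f1 : Real.exp (-(2 * T)) ≤ Real.exp (T * s) ^ 2 := by
      rw [← Real.exp_nat_mul]; apply Real.exp_le_exp.mpr; push_cast; linarith
    have f2 : Real.exp (-(2 * T)) ≤ Real.exp (-(T * s)) ^ 2 := by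
      rw [← Real.exp_nat_mul]; apply Real.exp_le_exp.mpr; push_cast; linarith
    have hc : 0 < π * w.im := by positivity
    have f3 := mul_le_mul_of_nonneg_right f1 (sq_nonneg x)
    have f4 := mul_le_mul_of_nonneg_right f2 (sq_nonneg x')
    have f5 := mul_le_mul_of_nonneg_left (add_le_add f3 f4) hc.le
    rw [mul_pow, mul_pow]
    linarith

theorem sumint (K : IntermediateField ℚ ℝ) (σ : K ≃+* K) (e₁ e₂ a b : K)
    (hD : (e₁ : ℝ) * (σ e₂ : ℝ) - (σ e₁ : ℝ) * (e₂ : ℝ) ≠ 0) (c₁ c₂ : ℝ) (w : ℂ) (hw : 0 < w.im)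
    (T : ℝ) (hT : 0 < T) (ι : ℤ × ℤ → K) (hι : ∀ n, ι n = a + (n.1 * e₁ + n.2 * e₂)) :
    HasSum (fun n : ℤ × ℤ => (∫ s in (0 : ℝ)..1, gK c₁ c₂ w (Real.exp (T * s) * (ι n : ℝ))
        (Real.exp (-(T * s)) * (σ (ι n) : ℝ))) * chiK K σ a b (ι n))
      (∫ s in (0 : ℝ)..1, ∑' n : ℤ × ℤ, gK c₁ c₂ w (Real.exp (T * s) * (ι n : ℝ))
        (Real.exp (-(T * s)) * (σ (ι n) : ℝ)) * chiK K σ a b (ι n)) := by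
  have hc : 0 < π * w.im * Real.exp (-(2 * T)) := by positivity
  have hsum := summable_of_lin_gauss hc e₁ e₂ (σ e₁) (σ e₂) a (σ a) hD ((|c₁| + |c₂|) * Real.exp T)
  have hι1 : ∀ n, (ι n : ℝ) = a + n.1 * e₁ + n.2 * e₂ := by
    intro n; rw [hι]; push_cast; ring
  have hι2 : ∀ n, (σ (ι n) : ℝ) = σ a + n.1 * σ e₁ + n.2 * σ e₂ := by
    intro n; rw [hι, map_add, map_add, map_mul, map_mul, map_intCast, map_intCast]; push_cast; ring
  simp_rw [← hι1, ← hι2] at hsum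
  simp_rw [← intervalIntegral.integral_mul_const]
  have hb : ∀ (n : ℤ × ℤ) (s : ℝ), s ∈ Set.uIoc (0 : ℝ) 1 →
      ‖gK c₁ c₂ w (Real.exp (T * s) * (ι n : ℝ))
        (Real.exp (-(T * s)) * (σ (ι n) : ℝ)) * chiK K σ a b (ι n)‖ ≤
      (|c₁| + |c₂|) * Real.exp T * ((|(ι n : ℝ)| + |(σ (ι n) : ℝ)| + 1) *
        Real.exp (-(π * w.im * Real.exp (-(2 * T))) * ((ι n : ℝ) ^ 2 + (σ (ι n) : ℝ) ^ 2))) := by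
    intro n s hs
    rw [Set.uIoc_of_le zero_le_one] at hs
    rw [norm_mul, norm_chiK, mul_one]
    exact gK_scaled_bound c₁ c₂ w hw T hT (ι n) (σ (ι n)) s hs.1.le hs.2
  refine intervalIntegral.hasSum_integral_of_dominated_convergence (fun n _ => _) ?_
    (fun n => Filter.Eventually.of_forall (hb n)) (Filter.Eventually.of_forall fun s hs => hsum)
    ?_ ?_
  · intro n
    apply Continuous.aestronglyMeasurable
    unfold gK
    fun_prop
  · exact intervalIntegrable_const
  · refine Filter.Eventually.of_forall fun s hs => ?_
    exact (Summable.of_norm_bounded hsum (fun n => hb n s hs)).hasSum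

theorem unfolding (K : IntermediateField ℚ ℝ) (σ : K ≃+* K) (e₁ e₂ a b ε : K)
    (hD : (e₁ : ℝ) * (σ e₂ : ℝ) - (σ e₁ : ℝ) * (e₂ : ℝ) ≠ 0)
    (hε1 : 1 < (ε : ℝ)) (hεnorm : ε * σ ε = 1)
    (ι : ℤ × ℤ → K) (hι : ∀ n, ι n = a + (n.1 * e₁ + n.2 * e₂))
    (hmul : ∀ x, x ∈ Set.range ι ↔ ε * x ∈ Set.range ι)
    (hchi : ∀ x ∈ Set.range ι, chiK K σ a b (ε * x) = chiK K σ a b x)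
    (S : Set K) (hSsub : S ⊆ Set.range ι)
    (hSrep : ∀ x ∈ Set.range ι, ∃! y : K, y ∈ S ∧ ∃ n : ℤ, y = ε ^ n * x)
    (ξ₀ ξ₁ : ℝ) (w : ℂ) (hw : 0 < w.im) :
    HasSum (fun x : S => thetaTerm K σ ξ₀ ξ₁ a b w (x : K))
      ((2 * (Real.log ε : ℝ) * (-Complex.I * w) ^ (1 / 2 : ℂ)) *
      ∫ s in (0 : ℝ)..1, ∑' n : ℤ × ℤ, gK ξ₁ ξ₀ w (Real.exp (Real.log ε * s) * (ι n : ℝ))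
        (Real.exp (-(Real.log ε * s)) * (σ (ι n) : ℝ)) * chiK K σ a b (ι n)) := by
  have hw0 : w ≠ 0 := by rintro rfl; simp at hw
  set T := Real.log ε with hTdef
  have hT : 0 < T := Real.log_pos hε1
  have hεpos : (0 : ℝ) < ε := by linarith
  have hε0 : ε ≠ 0 := by rintro rfl; simp at hεpos
  have hexpT : Real.exp T = ε := Real.exp_log hεpos
  have hσε : (σ ε : ℝ) = (ε : ℝ)⁻¹ := by
    have : (ε : ℝ) * (σ ε : ℝ) = 1 := by exact_mod_cast congrArg (fun z : K => (z : ℝ)) hεnorm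
    field_simp; linarith
  have hzinj : ∀ n m : ℤ, ε ^ n = ε ^ m → n = m := by
    intro n m h
    have h' : (ε : ℝ) ^ n = (ε : ℝ) ^ m := by
      have := congrArg (fun z : K => (z : ℝ)) h
      simpa only [coeK_zpow] using this
    exact zpow_right_injective₀ hεpos hε1.ne' h'
  have hιinj : Function.Injective ι := by
    rintro ⟨n, m⟩ ⟨n', m'⟩ h
    have h1 : (ι (n, m) : ℝ) = ι (n', m') := by rw [h]
    have h2 : (σ (ι (n, m)) : ℝ) = σ (ι (n', m')) := by rw [h]
    simp only [hι, map_add, map_mul, map_intCast] at h1 h2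
    push_cast at h1 h2
    have h3 : ((n : ℝ) - n') * (e₁ * (σ e₂ : ℝ) - (σ e₁ : ℝ) * e₂) = 0 := by
      linear_combination (σ e₂ : ℝ) * h1 - (e₂ : ℝ) * h2
    have h4 : ((m : ℝ) - m') * (e₁ * (σ e₂ : ℝ) - (σ e₁ : ℝ) * e₂) = 0 := by
      linear_combination (-(σ e₁ : ℝ)) * h1 + (e₁ : ℝ) * h2
    have h5 := (mul_eq_zero.mp h3).resolve_right hD
    have h6 := (mul_eq_zero.mp h4).resolve_right hD
    rw [sub_eq_zero] at h5 h6
    exact Prod.ext (by exact_mod_cast h5) (by exact_mod_cast h6)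
  have horb : ∀ x ∈ Set.range ι, ∀ n : ℤ, ε ^ n * x ∈ Set.range ι ∧
      chiK K σ a b (ε ^ n * x) = chiK K σ a b x := by
    intro x hx n
    induction n using Int.induction_on with
    | zero => simpa using hx
    | succ n ih =>
      have : ε ^ ((n : ℤ) + 1) * x = ε * (ε ^ (n : ℤ) * x) := by rw [zpow_add_one₀ hε0]; ring
      rw [this]
      exact ⟨(hmul _).mp ih.1, (hchi _ ih.1).trans ih.2⟩
    | pred n ih =>
      have : ε ^ (-(n : ℤ)) * x = ε * (ε ^ (-(n : ℤ) - 1) * x) := by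
        rw [zpow_sub_one₀ hε0]; field_simp
      rw [this] at ih
      have h1 := (hmul _).mpr ih.1
      exact ⟨h1, (hchi _ h1).symm.trans ih.2⟩
  let H : K → ℝ → ℂ := fun x s => gK ξ₁ ξ₀ w (Real.exp (T * s) * (x : ℝ))
        (Real.exp (-(T * s)) * (σ x : ℝ))
  let Φ : K → ℂ := fun x => (∫ s in (0 : ℝ)..1, H x s) * chiK K σ a b x
  have hΦ0 : Φ 0 = 0 := by simp [Φ, H, gK_zero]
  set I := ∫ s in (0 : ℝ)..1, ∑' n : ℤ × ℤ, gK ξ₁ ξ₀ w (Real.exp (T * s) * (ι n : ℝ))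
        (Real.exp (-(T * s)) * (σ (ι n) : ℝ)) * chiK K σ a b (ι n) with hI
  have hs1 : HasSum (fun n => Φ (ι n)) I := sumint K σ e₁ e₂ a b hD ξ₁ ξ₀ w hw T hT ι hι
  let f : K → ℂ := (Set.range ι).indicator Φ
  have hs2 : HasSum f I := by
    rw [← hιinj.hasSum_iff (f := f) (fun x hx => Set.indicator_of_notMem hx _)]
    refine hs1.congr_fun ?_ |> id
    intro n
    simp [f]
  let S' := {x : S // (x : K) ≠ 0}
  let g : S' × ℤ → K := fun p => ε ^ p.2 * (p.1.1 : K)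
  have hginj : Function.Injective g := by
    rintro ⟨⟨⟨x, hx⟩, hx0⟩, n⟩ ⟨⟨⟨y, hy⟩, hy0⟩, m⟩ h
    simp only [g] at h
    have hxy : y = ε ^ (n - m) * x := by
      have h1 : ε ^ m ≠ 0 := zpow_ne_zero _ hε0
      rw [zpow_sub₀ hε0, div_mul_eq_mul_div, h]; field_simp
    have heq : x = y := (hSrep x (hSsub hx)).unique ⟨hx, 0, by simp⟩ ⟨hy, n - m, hxy⟩
    subst heq
    have hnm : n = m := hzinj n m (mul_right_cancel₀ hx0 h)
    subst hnm
    rfl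
  have hs3 : HasSum (f ∘ g) I := by
    rw [hginj.hasSum_iff]
    · exact hs2
    · intro x hx
      by_cases hxr : x ∈ Set.range ι
      · by_cases hx0 : x = 0
        · rw [hx0]; simp only [f, Set.indicator]; split_ifs <;> simp [hΦ0]
        · exfalso
          apply hx
          obtain ⟨y, ⟨hyS, n, hy⟩, -⟩ := hSrep x hxr
          have hzn : ε ^ n ≠ 0 := zpow_ne_zero _ hε0
          have hy0 : y ≠ 0 := by rw [hy]; exact mul_ne_zero hzn hx0
          refine ⟨(⟨⟨y, hyS⟩, hy0⟩, -n), ?_⟩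
          simp only [g]
          rw [hy, zpow_neg]; field_simp
      · exact Set.indicator_of_notMem hxr _
  have hσ0 : ∀ x : K, x ≠ 0 → (σ x : ℝ) ≠ 0 := by
    intro x hx h
    apply hx
    have : σ x = 0 := by exact_mod_cast h
    simpa using this
  have hfib : ∀ x : S', HasSum (fun n : ℤ => (f ∘ g) (x, n))
      ((∫ s, H (x.1 : K) s) * chiK K σ a b (x.1 : K)) := by
    rintro ⟨⟨x, hxS⟩, hx0⟩
    have hx0R : (x : ℝ) ≠ 0 := by exact_mod_cast hx0
    have hinteg : MeasureTheory.Integrable (H x) := (kern3 w hw T hT ξ₁ ξ₀ x (σ x) hx0R (hσ0 x hx0)).1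
    have := hinteg.hasSum_intervalIntegral_comp_add_int.mul_right (chiK K σ a b x)
    convert! this using 1
    funext n
    simp only [Function.comp, f, g]
    obtain ⟨h1, h2⟩ := horb x (hSsub hxS) n
    rw [Set.indicator_of_mem h1]
    simp only [Φ, h2]
    congr 1
    apply intervalIntegral.integral_congr
    intro s _
    simp only [H]
    have hz : Real.exp (T * n) = (ε : ℝ) ^ n := by
      rw [Real.exp_mul, hexpT, Real.rpow_intCast]
    congr 1
    · rw [mul_add, Real.exp_add, hz, MulMemClass.coe_mul, coeK_zpow]; ring
    · rw [mul_add, neg_add, Real.exp_add, Real.exp_neg (T * n), hz, map_mul, map_zpow₀]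
      rw [MulMemClass.coe_mul, coeK_zpow, hσε, inv_zpow]; ring
  have hs4 := (hs3.prod_fiberwise hfib).mul_left (2 * (T : ℂ) * (-Complex.I * w) ^ (1 / 2 : ℂ))
  have hTC : (T : ℂ) ≠ 0 := by exact_mod_cast hT.ne'
  have hR0 : (-Complex.I * w) ^ (1 / 2 : ℂ) ≠ 0 := by
    rw [Complex.cpow_ne_zero_iff]; left
    exact mul_ne_zero (neg_ne_zero.mpr Complex.I_ne_zero) hw0
  have hinjS : Function.Injective (fun x : S' => x.1) := Subtype.val_injective
  rw [← hinjS.hasSum_iff]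
  · convert! hs4 using 1
    funext x
    obtain ⟨⟨x, hxS⟩, hx0⟩ := x
    have hx0R : (x : ℝ) ≠ 0 := by exact_mod_cast hx0
    have hval := (kern3 w hw T hT ξ₁ ξ₀ x (σ x) hx0R (hσ0 x hx0)).2
    simp only [Function.comp, H]
    rw [hval, thetaTerm, chiK]
    field_simp
  · intro x hx
    have hx0 : (x : K) = 0 := by
      by_contra h
      exact hx ⟨⟨x, h⟩, rfl⟩
    rw [thetaTerm, hx0]
    simp

theorem sigma_invol (K : IntermediateField ℚ ℝ) (hK2 : Module.finrank ℚ K = 2)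
    (σ : K ≃+* K) (x : K) : σ (σ x) = x := by
  have : FiniteDimensional ℚ K := FiniteDimensional.of_finrank_pos (by omega)
  let τ : K ≃ₐ[ℚ] K := AlgEquiv.ofRingEquiv (f := σ) (fun q => by simp)
  have hc : Fintype.card (K ≃ₐ[ℚ] K) ≤ 2 := hK2 ▸ AlgEquiv.card_le
  have hp : τ ^ 2 = 1 := by
    have h0 : 0 < Fintype.card (K ≃ₐ[ℚ] K) := Fintype.card_pos
    have h1 : τ ^ Fintype.card (K ≃ₐ[ℚ] K) = 1 := pow_card_eq_one
    rcases (by omega : Fintype.card (K ≃ₐ[ℚ] K) = 1 ∨ Fintype.card (K ≃ₐ[ℚ] K) = 2) with h | h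
    · rw [h, pow_one] at h1; rw [h1, one_pow]
    · rwa [h] at h1
  have := congrArg (fun f : K ≃ₐ[ℚ] K => f x) hp
  simpa [pow_two, τ] using this

theorem det_ne_zero_K (K : IntermediateField ℚ ℝ) (hK2 : Module.finrank ℚ K = 2)
    (σ : K ≃+* K) (hσ : ∃ x : K, σ x ≠ x)
    (l₁ l₂ : K) (hli : LinearIndependent ℚ ![(l₁ : ℝ), (l₂ : ℝ)]) :
    l₁ * σ l₂ - σ l₁ * l₂ ≠ 0 := by
  intro hD
  have hli' : LinearIndependent ℚ ![l₁, l₂] := by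
    apply LinearIndependent.of_comp K.val.toLinearMap
    convert! hli using 1
    funext i; fin_cases i <;> rfl
  have hspan := hli'.span_eq_top_of_card_eq_finrank (by simp [hK2])
  have key : ∀ x : K, σ x * l₁ = x * σ l₁ := by
    intro x
    have hx : x ∈ Submodule.span ℚ (Set.range ![l₁, l₂]) := by rw [hspan]; trivial
    rw [Matrix.range_cons_cons_empty, Submodule.mem_span_pair] at hx
    obtain ⟨p, q, rfl⟩ := hx
    simp only [map_add, Rat.smul_def, map_mul, map_ratCast]
    linear_combination (q : K) * hD
  have h1 : l₁ = σ l₁ := by simpa using key 1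
  have hl₁ : l₁ ≠ 0 := by simpa using hli'.ne_zero 0
  obtain ⟨x, hx⟩ := hσ
  apply hx
  have := key x
  rw [← h1] at this
  exact mul_right_cancel₀ hl₁ this

theorem integrand_identity (K : IntermediateField ℚ ℝ) (σ : K ≃+* K) (hinv : ∀ x, σ (σ x) = x)
    (l₁ l₂ d₁ d₂ l₀ m₀ : K)
    (hD : (l₁ : ℝ) * (σ l₂ : ℝ) - (σ l₁ : ℝ) * (l₂ : ℝ) ≠ 0)
    (h11 : (σ l₁ : ℝ) * d₁ + l₁ * (σ d₁ : ℝ) = 1) (h21 : (σ l₂ : ℝ) * d₁ + l₂ * (σ d₁ : ℝ) = 0)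
    (h12 : (σ l₁ : ℝ) * d₂ + l₁ * (σ d₂ : ℝ) = 0) (h22 : (σ l₂ : ℝ) * d₂ + l₂ * (σ d₂ : ℝ) = 1)
    (η₀ η₁ : ℝ) (v : ℂ) (hv : 0 < v.im) (E F : ℝ) (hEF : E * F = 1)
    (ι κ : ℤ × ℤ → K) (hι : ∀ n, ι n = l₀ + (n.1 * l₁ + n.2 * l₂))
    (hκ : ∀ n, κ n = m₀ + (n.1 * d₁ + n.2 * d₂)) :
    ∑' n : ℤ × ℤ, gK η₁ η₀ v (E * (ι n : ℝ)) (F * (σ (ι n) : ℝ)) * chiK K σ l₀ m₀ (ι n) =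
      1 / (((|(l₁ : ℝ) * (σ l₂ : ℝ) - (σ l₁ : ℝ) * (l₂ : ℝ)| : ℝ) : ℂ) * (-Complex.I * v) * v) *
      ∑' n : ℤ × ℤ, gK η₀ η₁ (-1 / v) (E * (κ n : ℝ)) (F * (σ (κ n) : ℝ)) *
        chiK K σ m₀ (-l₀) (κ n) := by
  have hι1 : ∀ n, (ι n : ℝ) = l₀ + (n.1 * l₁ + n.2 * l₂) := by
    intro n; rw [hι]; push_cast; ring
  have hι2 : ∀ n, (σ (ι n) : ℝ) = σ l₀ + (n.1 * σ l₁ + n.2 * σ l₂) := by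
    intro n; rw [hι, map_add, map_add, map_mul, map_mul, map_intCast, map_intCast]; push_cast; ring
  have hκ1 : ∀ n, (κ n : ℝ) = m₀ + (n.1 * d₁ + n.2 * d₂) := by
    intro n; rw [hκ]; push_cast; ring
  have hκ2 : ∀ n, (σ (κ n) : ℝ) = σ m₀ + (n.1 * σ d₁ + n.2 * σ d₂) := by
    intro n; rw [hκ, map_add, map_add, map_mul, map_mul, map_intCast, map_intCast]; push_cast; ring
  have hdet : (E * l₁) * (F * (σ l₂ : ℝ)) - (F * (σ l₁ : ℝ)) * (E * l₂) =
      (l₁ : ℝ) * (σ l₂ : ℝ) - (σ l₁ : ℝ) * (l₂ : ℝ) := by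
    linear_combination ((l₁ : ℝ) * (σ l₂ : ℝ) - (σ l₁ : ℝ) * (l₂ : ℝ)) * hEF
  have P := poisson2 v hv (E * l₁) (E * l₂) (F * σ l₁) (F * σ l₂) (E * l₀) (F * σ l₀)
    (l₁ * σ m₀ + σ l₁ * m₀) (l₂ * σ m₀ + σ l₂ * m₀) η₁ η₀ (by rw [hdet]; exact hD)
    (fun n => F * σ (κ n)) (fun n => E * κ n)
    (by
      intro n
      rw [hκ1, hκ2]
      linear_combination (l₁ * (σ m₀ + (n.1 * σ d₁ + n.2 * σ d₂)) +
        σ l₁ * (m₀ + (n.1 * d₁ + n.2 * d₂)) : ℝ) * hEF + (n.1 : ℝ) * h11 + (n.2 : ℝ) * h12)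
    (by
      intro n
      rw [hκ1, hκ2]
      linear_combination (l₂ * (σ m₀ + (n.1 * σ d₁ + n.2 * σ d₂)) +
        σ l₂ * (m₀ + (n.1 * d₁ + n.2 * d₂)) : ℝ) * hEF + (n.1 : ℝ) * h21 + (n.2 : ℝ) * h22)
  rw [hdet] at P
  have Q := congrArg (fun z : ℂ => z *
    Complex.exp (-(π : ℂ) * Complex.I * ((trK K σ (l₀ * σ m₀) : ℝ) : ℂ))) P
  rw [mul_assoc (1 / _), ← tsum_mul_right, ← tsum_mul_right] at Q
  convert! Q using 1
  · congr 1
    funext n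
    rw [chiK, ← mul_assoc]
    congr 2
    · rw [hι1, hι2]; congr 1 <;> ring
    · congr 3
      rw [trK, map_mul, hinv, map_sub]
      push_cast
      rw [hι1, hι2]
      push_cast
      ring
  · congr 2
    funext n
    rw [chiK, mul_assoc (gK η₁ _ _ _ _)]
    congr 1
    · rw [gK, gK]
      congr 2
      · push_cast; ring
      · push_cast; ring
    · rw [← Complex.exp_add, ← Complex.exp_add]
      congr 1
      have e : (E * l₀ * (F * σ (κ n)) + F * σ l₀ * (E * κ n) : ℝ) =
          (l₀ * σ (κ n) + σ l₀ * κ n : ℝ) := by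
        linear_combination (l₀ * σ (κ n) + σ l₀ * κ n : ℝ) * hEF
      rw [e]
      simp only [trK, map_mul, hinv, map_sub, map_neg]
      push_cast
      ring

theorem exp_int_period (t : ℝ) (h : ∃ n : ℤ, t = n) :
    Complex.exp (-2 * (π : ℂ) * Complex.I * (t : ℂ)) = 1 := by
  obtain ⟨n, rfl⟩ := h
  rw [Complex.exp_eq_one_iff]
  exact ⟨-n, by push_cast; ring⟩

theorem chiK_invariant (K : IntermediateField ℚ ℝ) (σ : K ≃+* K) (a b ε x : K)
    (h : ∃ n : ℤ, trK K σ ((ε - 1) * x * σ b) = n) :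
    chiK K σ a b (ε * x) = chiK K σ a b x := by
  have e : trK K σ ((ε * x - a) * σ b) =
      trK K σ ((x - a) * σ b) + trK K σ ((ε - 1) * x * σ b) := by
    simp only [trK, map_mul, map_sub, map_one]
    push_cast
    ring
  rw [chiK, chiK, e, Complex.ofReal_add, mul_add, Complex.exp_add, exp_int_period _ h, mul_one]

theorem trK_add (K : IntermediateField ℚ ℝ) (σ : K ≃+* K) (x y : K) :
    trK K σ (x + y) = trK K σ x + trK K σ y := by
  simp only [trK, map_add]
  push_cast
  ring

theorem trK_neg (K : IntermediateField ℚ ℝ) (σ : K ≃+* K) (x : K) :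
    trK K σ (-x) = - trK K σ x := by
  simp only [trK, map_neg]
  push_cast
  ring

theorem unfolding_coset (K : IntermediateField ℚ ℝ) (σ : K ≃+* K) (e₁ e₂ a b ε : K)
    (hD : (e₁ : ℝ) * (σ e₂ : ℝ) - (σ e₁ : ℝ) * (e₂ : ℝ) ≠ 0)
    (hε1 : 1 < (ε : ℝ)) (hεnorm : ε * σ ε = 1)
    (N : Set K) (hN : ∀ x, x ∈ N ↔ ∃ j k : ℤ, x = j * e₁ + k * e₂)
    (hεN : ∀ x, x ∈ N ↔ ε * x ∈ N) (hεa : (ε - 1) * a ∈ N)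
    (hc1 : ∀ l ∈ N, ∃ n : ℤ, trK K σ ((ε - 1) * l * σ b) = (n : ℝ))
    (hc2 : ∃ n : ℤ, trK K σ ((ε - 1) * a * σ b) = (n : ℝ))
    (S : Set K) (hSsub : S ⊆ {x : K | ∃ l ∈ N, x = a + l})
    (hSrep : ∀ x : K, (∃ l ∈ N, x = a + l) → ∃! y : K, y ∈ S ∧ ∃ n : ℤ, y = ε ^ n * x)
    (ι : ℤ × ℤ → K) (hι : ∀ n, ι n = a + (n.1 * e₁ + n.2 * e₂))
    (ξ₀ ξ₁ : ℝ) (w : ℂ) (hw : 0 < w.im) :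
    HasSum (fun x : S => thetaTerm K σ ξ₀ ξ₁ a b w (x : K))
      ((2 * (Real.log ε : ℝ) * (-Complex.I * w) ^ (1 / 2 : ℂ)) *
      ∫ s in (0 : ℝ)..1, ∑' n : ℤ × ℤ, gK ξ₁ ξ₀ w (Real.exp (Real.log ε * s) * (ι n : ℝ))
        (Real.exp (-(Real.log ε * s)) * (σ (ι n) : ℝ)) * chiK K σ a b (ι n)) := by
  have hr : ∀ x, x ∈ Set.range ι ↔ ∃ l ∈ N, x = a + l := by
    intro x
    constructor
    · rintro ⟨n, rfl⟩
      exact ⟨_, (hN _).mpr ⟨n.1, n.2, rfl⟩, hι n⟩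
    · rintro ⟨l, hl, rfl⟩
      obtain ⟨j, k, rfl⟩ := (hN l).mp hl
      exact ⟨(j, k), hι _⟩
  have hadd : ∀ x y, x ∈ N → y ∈ N → x + y ∈ N := by
    intro x y hx hy
    obtain ⟨j, k, rfl⟩ := (hN x).mp hx
    obtain ⟨j', k', rfl⟩ := (hN y).mp hy
    exact (hN _).mpr ⟨j + j', k + k', by push_cast; ring⟩
  have hsub : ∀ x y, x ∈ N → y ∈ N → x - y ∈ N := by
    intro x y hx hy
    obtain ⟨j, k, rfl⟩ := (hN x).mp hx
    obtain ⟨j', k', rfl⟩ := (hN y).mp hy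
    exact (hN _).mpr ⟨j - j', k - k', by push_cast; ring⟩
  refine unfolding K σ e₁ e₂ a b ε hD hε1 hεnorm ι hι ?_ ?_ S
    (fun x hx => (hr x).mpr (hSsub hx)) (fun x hx => hSrep x ((hr x).mp hx)) ξ₀ ξ₁ w hw
  · intro x
    rw [hr, hr]
    constructor
    · rintro ⟨l, hl, rfl⟩
      exact ⟨(ε - 1) * a + ε * l, hadd _ _ hεa ((hεN l).mp hl), by ring⟩
    · rintro ⟨l, hl, h⟩
      refine ⟨x - a, (hεN _).mpr ?_, by ring⟩
      have : ε * (x - a) = l - (ε - 1) * a := by linear_combination h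
      rw [this]
      exact hsub _ _ hl hεa
  · intro x hx
    obtain ⟨l, hl, rfl⟩ := (hr x).mp hx
    apply chiK_invariant
    obtain ⟨n, hn⟩ := hc1 l hl
    obtain ⟨m, hm⟩ := hc2
    refine ⟨m + n, ?_⟩
    rw [mul_add, add_mul, trK_add, hn, hm]
    push_cast
    ring

theorem const_identity (v : ℂ) (hv : 0 < v.im) (T D : ℂ) :
    (2 * T * (-Complex.I * v) ^ (1 / 2 : ℂ)) * (1 / (D * (-Complex.I * v) * v)) =
      1 / (D * v) * (2 * T * (-Complex.I * (-1 / v)) ^ (1 / 2 : ℂ)) := by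
  have hv0 : v ≠ 0 := by rintro rfl; simp at hv
  have hw0 : -Complex.I * v ≠ 0 := mul_ne_zero (neg_ne_zero.mpr Complex.I_ne_zero) hv0
  have h1 : -Complex.I * (-1 / v) = (-Complex.I * v)⁻¹ := by
    field_simp
    rw [Complex.I_sq]
  have hre : 0 < (-Complex.I * v).re := by simpa using hv
  have harg : (-Complex.I * v).arg ≠ π := by
    intro h
    have := Complex.arg_eq_pi_iff.mp h
    linarith [this.1]
  rw [h1, Complex.inv_cpow _ _ harg]
  have hR0 : (-Complex.I * v) ^ (1 / 2 : ℂ) ≠ 0 := by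
    rw [Complex.cpow_ne_zero_iff]; exact Or.inl hw0
  have hRR : (-Complex.I * v) ^ (1 / 2 : ℂ) * (-Complex.I * v) ^ (1 / 2 : ℂ) = -Complex.I * v := by
    rw [← Complex.cpow_add _ _ hw0]; norm_num
  generalize (-Complex.I * v) ^ (1 / 2 : ℂ) = R at hR0 hRR ⊢
  rw [← hRR]
  by_cases hD : D = 0
  · simp [hD]
  · field_simp

/-- Proposition 2.9, functional equation for the indefinite theta
functions of real quadratic pseudolattices: with `L = ℤl₁ + ℤl₂`,
`L^? = {m : Tr(σ(l)m) ∈ ℤ ∀ l ∈ L}`, `Δ(L) = |l₁σ(l₂) − σ(l₁)l₂|`, and a unit `ε`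
preserving all the data, for `Im v > 0`:
`Θ(L, η₀, η₁, l₀, m₀, S)(v) = (1/(Δ(L)v))·Θ(L^?, η₁, η₀, m₀, −l₀, S')(−1/v)`. -/
theorem stmt_18 (K : IntermediateField ℚ ℝ) (hK2 : Module.finrank ℚ K = 2)
    (σ : K ≃+* K) (hσ : ∃ x : K, σ x ≠ x)
    (l₁ l₂ : K) (hli : LinearIndependent ℚ ![(l₁ : ℝ), (l₂ : ℝ)])
    (l₀ m₀ : K) (η₀ η₁ : ℝ) (ε : K)
    (L : AddSubgroup K) (hL : L = AddSubgroup.closure {l₁, l₂})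
    (Ldual : Set K) (hLd : Ldual = {m : K | ∀ l ∈ L, ∃ n : ℤ, trK K σ (σ l * m) = (n : ℝ)})
    (hε1 : 1 < (ε : ℝ)) (hεnorm : ε * σ ε = 1)
    (hεL : ∀ l : K, l ∈ L ↔ ε * l ∈ L)
    (hεLd : ∀ m : K, m ∈ Ldual ↔ ε * m ∈ Ldual)
    (hεl₀ : (ε - 1) * l₀ ∈ L)
    (hεm₀ : (ε - 1) * m₀ ∈ Ldual)
    (hchar1 : ∀ l ∈ L, ∃ n : ℤ, trK K σ ((ε - 1) * l * σ m₀) = (n : ℝ))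
    (hchar2 : ∃ n : ℤ, trK K σ ((ε - 1) * l₀ * σ m₀) = ((2 * n : ℤ) : ℝ))
    (hchar3 : ∀ m ∈ Ldual, ∃ n : ℤ, trK K σ ((ε - 1) * m * σ l₀) = (n : ℝ))
    (hchar4 : ∃ n : ℤ, trK K σ ((ε - 1) * m₀ * σ l₀) = ((2 * n : ℤ) : ℝ))
    (S : Set K)
    (hSsub : S ⊆ {x : K | ∃ l ∈ L, x = l₀ + l})
    (hSrep : ∀ x : K, (∃ l ∈ L, x = l₀ + l) →
      ∃! y : K, y ∈ S ∧ ∃ n : ℤ, y = ε ^ n * x)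
    (S' : Set K)
    (hS'sub : S' ⊆ {x : K | ∃ m ∈ Ldual, x = m₀ + m})
    (hS'rep : ∀ x : K, (∃ m ∈ Ldual, x = m₀ + m) →
      ∃! y : K, y ∈ S' ∧ ∃ n : ℤ, y = ε ^ n * x)
    (v : ℂ) (hv : 0 < v.im) :
    Summable (fun x : S => ‖thetaTerm K σ η₀ η₁ l₀ m₀ v (x : K)‖) ∧
    Summable (fun x : S' => ‖thetaTerm K σ η₁ η₀ m₀ (-l₀) (-1 / v) (x : K)‖) ∧
    theta K σ S η₀ η₁ l₀ m₀ v =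
      1 / (((|(l₁ : ℝ) * (σ l₂ : ℝ) - (σ l₁ : ℝ) * (l₂ : ℝ)| : ℝ) : ℂ) * v) *
        theta K σ S' η₁ η₀ m₀ (-l₀) (-1 / v) := by
  have hinv := sigma_invol K hK2 σ
  have hDK := det_ne_zero_K K hK2 σ hσ l₁ l₂ hli
  set D : K := l₁ * σ l₂ - σ l₁ * l₂ with hDdef
  have hσD : σ D = -D := by
    rw [hDdef, map_sub, map_mul, map_mul, hinv, hinv]; ring
  have hDR : (l₁ : ℝ) * (σ l₂ : ℝ) - (σ l₁ : ℝ) * (l₂ : ℝ) ≠ 0 := by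
    intro h
    apply hDK
    apply Subtype.ext
    rw [hDdef]
    push_cast
    exact h
  set d₁ : K := -l₂ / D with hd₁
  set d₂ : K := l₁ / D with hd₂
  have hσd₁ : σ d₁ = σ l₂ / D := by
    rw [hd₁, map_div₀, map_neg, hσD, neg_div_neg_eq]
  have hσd₂ : σ d₂ = -σ l₁ / D := by
    rw [hd₂, map_div₀, hσD, div_neg, neg_div]
  have k11 : σ l₁ * d₁ + l₁ * σ d₁ = 1 := by
    rw [hσd₁, hd₁]; field_simp; rw [hDdef]; ring
  have k21 : σ l₂ * d₁ + l₂ * σ d₁ = 0 := by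
    rw [hσd₁, hd₁]; field_simp; ring
  have k12 : σ l₁ * d₂ + l₁ * σ d₂ = 0 := by
    rw [hσd₂, hd₂]; field_simp; ring
  have k22 : σ l₂ * d₂ + l₂ * σ d₂ = 1 := by
    rw [hσd₂, hd₂]; field_simp; rw [hDdef]; ring
  have h11 : (σ l₁ : ℝ) * d₁ + l₁ * (σ d₁ : ℝ) = 1 := by
    have := congrArg (fun z : K => (z : ℝ)) k11
    push_cast at this; exact this
  have h21 : (σ l₂ : ℝ) * d₁ + l₂ * (σ d₁ : ℝ) = 0 := by
    have := congrArg (fun z : K => (z : ℝ)) k21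
    push_cast at this; exact this
  have h12 : (σ l₁ : ℝ) * d₂ + l₁ * (σ d₂ : ℝ) = 0 := by
    have := congrArg (fun z : K => (z : ℝ)) k12
    push_cast at this; exact this
  have h22 : (σ l₂ : ℝ) * d₂ + l₂ * (σ d₂ : ℝ) = 1 := by
    have := congrArg (fun z : K => (z : ℝ)) k22
    push_cast at this; exact this
  have hdDR : (d₁ : ℝ) * (σ d₂ : ℝ) - (σ d₁ : ℝ) * (d₂ : ℝ) ≠ 0 := by
    intro h
    have : ((l₁ : ℝ) * (σ l₂ : ℝ) - (σ l₁ : ℝ) * (l₂ : ℝ)) *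
        ((d₁ : ℝ) * (σ d₂ : ℝ) - (σ d₁ : ℝ) * (d₂ : ℝ)) = -1 := by
      linear_combination (-1 : ℝ) * (((σ l₂ : ℝ) * d₂ + l₂ * (σ d₂ : ℝ)) * h11 + h22 -
        ((σ l₂ : ℝ) * d₁ + l₂ * (σ d₁ : ℝ)) * h12)
    rw [h] at this
    norm_num at this
  have hLmem : ∀ x, x ∈ (L : Set K) ↔ ∃ j k : ℤ, x = j * l₁ + k * l₂ := by
    intro x
    rw [SetLike.mem_coe, hL, AddSubgroup.mem_closure_pair]
    simp only [zsmul_eq_mul, eq_comm]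
  have hLdmem : ∀ x, x ∈ Ldual ↔ ∃ j k : ℤ, x = j * d₁ + k * d₂ := by
    intro x
    rw [hLd]
    constructor
    · intro hx
      obtain ⟨j, hj⟩ := hx l₁ ((hLmem _).mpr ⟨1, 0, by simp⟩)
      obtain ⟨k, hk⟩ := hx l₂ ((hLmem _).mpr ⟨0, 1, by simp⟩)
      rw [trK, map_mul, hinv] at hj hk
      have hj' : σ l₁ * x + l₁ * σ x = j := by
        apply Subtype.ext; push_cast at hj ⊢; exact hj
      have hk' : σ l₂ * x + l₂ * σ x = k := by
        apply Subtype.ext; push_cast at hk ⊢; exact hk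
      refine ⟨j, k, ?_⟩
      rw [hd₁, hd₂]
      field_simp
      rw [hDdef]
      linear_combination (-l₂) * hj' + l₁ * hk'
    · rintro ⟨j, k, rfl⟩ l hl
      obtain ⟨p, q, rfl⟩ := (hLmem l).mp hl
      refine ⟨p * j + q * k, ?_⟩
      simp only [trK, map_mul, map_add, map_intCast, hinv]
      push_cast
      linear_combination (p * j : ℝ) * h11 + (p * k : ℝ) * h12 + (q * j : ℝ) * h21 +
        (q * k : ℝ) * h22
  have H1 := unfolding_coset K σ l₁ l₂ l₀ m₀ ε hDR hε1 hεnorm (L : Set K) hLmem hεL hεl₀ hchar1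
    (by obtain ⟨n, hn⟩ := hchar2; exact ⟨2 * n, hn⟩) S hSsub hSrep
    (fun n => l₀ + (n.1 * l₁ + n.2 * l₂)) (fun n => rfl) η₀ η₁ v hv
  have H2 := unfolding_coset K σ d₁ d₂ m₀ (-l₀) ε hdDR hε1 hεnorm Ldual hLdmem hεLd hεm₀
    (by
      intro l hl
      obtain ⟨n, hn⟩ := hchar3 l hl
      exact ⟨-n, by rw [map_neg, mul_neg, trK_neg, hn]; push_cast; ring⟩)
    (by
      obtain ⟨n, hn⟩ := hchar4
      exact ⟨-(2 * n), by rw [map_neg, mul_neg, trK_neg, hn]; push_cast; ring⟩) S' hS'sub hS'rep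
    (fun n => m₀ + (n.1 * d₁ + n.2 * d₂)) (fun n => rfl) η₁ η₀ (-1 / v) (im_neg_inv hv)
  refine ⟨H1.summable.norm, H2.summable.norm, ?_⟩
  rw [theta, theta, H1.tsum_eq, H2.tsum_eq]
  have hinteg : ∀ s : ℝ, _ := fun s => integrand_identity K σ hinv l₁ l₂ d₁ d₂ l₀ m₀ hDR h11 h21 h12 h22
    η₀ η₁ v hv (Real.exp (Real.log ε * s)) (Real.exp (-(Real.log ε * s)))
    (by rw [← Real.exp_add]; simp) (fun n => l₀ + (n.1 * l₁ + n.2 * l₂))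
    (fun n => m₀ + (n.1 * d₁ + n.2 * d₂)) (fun n => rfl) (fun n => rfl)
  rw [intervalIntegral.integral_congr (fun s _ => hinteg s), intervalIntegral.integral_const_mul,
    ← mul_assoc, const_identity v hv, mul_assoc]
end
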